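/- Exact matching rate in the dual service-range model with no flexibility: In the dual service-range model: (a) for any base range r ≥ 0 and any p ∈ [0,1], if the extra range is b = 0 then lim_{n→∞} ν_n(r, 0, p)/n = r/(r + 1/2); and (b) for any r ≥ 0 and any b ≥ 0, if the flexible fraction is p = 0 then lim_{n→∞} ν_n(r, b, 0)/n = r/(r + 1/2). -/

import Mathlib

open MeasureTheory
open scoped Classical

noncomputable section

/-- A matching of a bipartite compatibility relation, given as a finite set of
supply-demand pairs with compatible endpoints and pairwise distinct coordinates. -/
def IsBipMatching {a b : ℕ} (adj : Fin a → Fin b → Prop) (M : Finset (Fin a × Fin b)) : Prop :=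
  (∀ e ∈ M, adj e.1 e.2) ∧
    ∀ e ∈ M, ∀ e' ∈ M, e ≠ e' → e.1 ≠ e'.1 ∧ e.2 ≠ e'.2

/-- The maximum cardinality of a matching of the bipartite compatibility relation. -/
def matchingNumber {a b : ℕ} (adj : Fin a → Fin b → Prop) : ℕ :=
  sSup {c | ∃ M : Finset (Fin a × Fin b), IsBipMatching adj M ∧ M.card = c}

/-- The uniform probability measure on `[0,1]`. -/
def unifI : Measure ℝ := volume.restrict (Set.Icc (0 : ℝ) 1)

/-- The expected maximum matching size `ν_n(r, b, p)` in the dual service-range model: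
`n` supply and `n` demand nodes i.i.d. uniform on `[0,1]`; exactly `⌊pn⌋` supply nodes
are flexible with range `r + b`, the rest have range `r`; supply `i` serves demand `j`
iff `|s_i - d_j| ≤ r_i / n`. -/
def nuDual (n : ℕ) (r b p : ℝ) : ℝ :=
  ∫ S : Fin n → ℝ, ∫ D : Fin n → ℝ,
      (matchingNumber (fun i j : Fin n =>
        |S i - D j| ≤ (if (i : ℕ) < Nat.floor (p * n) then r + b else r) / (n : ℝ)) : ℝ)
    ∂(Measure.pi fun _ => unifI) ∂(Measure.pi fun _ => unifI)

lemma le_matchingNumber {a b : ℕ} {adj : Fin a → Fin b → Prop} {M : Finset (Fin a × Fin b)}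
    (h : IsBipMatching adj M) : M.card ≤ matchingNumber adj := by
  apply le_csSup
  · refine ⟨Fintype.card (Fin a × Fin b), ?_⟩
    rintro c ⟨M, -, rfl⟩
    exact Finset.card_le_univ M
  · exact ⟨M, h, rfl⟩

lemma exists_matching {a b : ℕ} (adj : Fin a → Fin b → Prop) :
    ∃ M : Finset (Fin a × Fin b), IsBipMatching adj M ∧ M.card = matchingNumber adj := by
  have : matchingNumber adj ∈ {c | ∃ M : Finset (Fin a × Fin b), IsBipMatching adj M ∧ M.card = c} := by
    apply Nat.sSup_mem
    · exact ⟨0, ∅, ⟨by simp, by simp⟩, by simp⟩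
    · refine ⟨Fintype.card (Fin a × Fin b), ?_⟩
      rintro c ⟨M, -, rfl⟩
      exact Finset.card_le_univ M
  exact this

lemma matchingNumber_le_of_inj {a b a' b' : ℕ} {adj : Fin a → Fin b → Prop}
    {adj' : Fin a' → Fin b' → Prop} (f : Fin a → Fin a') (g : Fin b → Fin b')
    (hf : f.Injective) (hg : g.Injective) (h : ∀ i j, adj i j → adj' (f i) (g j)) :
    matchingNumber adj ≤ matchingNumber adj' := by
  obtain ⟨M, hM, hc⟩ := exists_matching adj
  rw [← hc, ← Finset.card_image_of_injective M (hf.prodMap hg)]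
  apply le_matchingNumber
  refine ⟨?_, ?_⟩
  · intro e he
    obtain ⟨e0, h0, rfl⟩ := Finset.mem_image.1 he
    exact h _ _ (hM.1 _ h0)
  · intro e he e' he' hne
    obtain ⟨e0, h0, rfl⟩ := Finset.mem_image.1 he
    obtain ⟨e1, h1, rfl⟩ := Finset.mem_image.1 he'
    have hne' : e0 ≠ e1 := fun h => hne (by rw [h])
    have := hM.2 _ h0 _ h1 hne'
    exact ⟨fun h => this.1 (hf h), fun h => this.2 (hg h)⟩

lemma card_filter_fst_le {a b : ℕ} {adj : Fin a → Fin b → Prop} {M : Finset (Fin a × Fin b)}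
    (h : IsBipMatching adj M) (i : Fin a) : (M.filter (fun e => e.1 = i)).card ≤ 1 := by
  rw [Finset.card_le_one]
  intro e he e' he'
  rw [Finset.mem_filter] at he he'
  by_contra hne
  exact (h.2 e he.1 e' he'.1 hne).1 (he.2.trans he'.2.symm)

lemma card_filter_snd_le {a b : ℕ} {adj : Fin a → Fin b → Prop} {M : Finset (Fin a × Fin b)}
    (h : IsBipMatching adj M) (i : Fin b) : (M.filter (fun e => e.2 = i)).card ≤ 1 := by
  rw [Finset.card_le_one]
  intro e he e' he'
  rw [Finset.mem_filter] at he he'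
  by_contra hne
  exact (h.2 e he.1 e' he'.1 hne).2 (he.2.trans he'.2.symm)

lemma matchingNumber_le_left {a b : ℕ} (adj : Fin a → Fin b → Prop) : matchingNumber adj ≤ a := by
  obtain ⟨M, hM, hc⟩ := exists_matching adj
  rw [← hc]
  have : M.card ≤ (Finset.univ : Finset (Fin a)).card := by
    apply Finset.card_le_card_of_injOn Prod.fst (by simp)
    intro e he e' he' h
    by_contra hne
    exact (hM.2 e he e' he' hne).1 h
  simpa using this

lemma matchingNumber_swap_le {a b : ℕ} (adj : Fin a → Fin b → Prop) :
    matchingNumber adj ≤ matchingNumber (fun j i => adj i j) := by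
  obtain ⟨M, hM, hc⟩ := exists_matching adj
  rw [← hc, ← Finset.card_image_of_injective M Prod.swap_injective]
  apply le_matchingNumber
  refine ⟨?_, ?_⟩
  · intro e he
    obtain ⟨e0, h0, rfl⟩ := Finset.mem_image.1 he
    exact hM.1 _ h0
  · intro e he e' he' hne
    obtain ⟨e0, h0, rfl⟩ := Finset.mem_image.1 he
    obtain ⟨e1, h1, rfl⟩ := Finset.mem_image.1 he'
    have hne' : e0 ≠ e1 := fun h => hne (by rw [h])
    have := hM.2 _ h0 _ h1 hne'
    exact ⟨this.2, this.1⟩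

lemma matching_pre {a b a' b' : ℕ} {adj : Fin a → Fin b → Prop}
    (f : Fin a' → Fin a) (g : Fin b' → Fin b) (hf : f.Injective) (hg : g.Injective)
    {M : Finset (Fin a × Fin b)} (h : IsBipMatching adj M) :
    IsBipMatching (fun i j => adj (f i) (g j))
      (Finset.univ.filter (fun e : Fin a' × Fin b' => (f e.1, g e.2) ∈ M)) := by
  refine ⟨?_, ?_⟩
  · intro e he
    exact h.1 _ (Finset.mem_filter.1 he).2
  · intro e he e' he' hne
    have := h.2 _ (Finset.mem_filter.1 he).2 _ (Finset.mem_filter.1 he').2 (by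
      intro hh
      rw [Prod.mk.injEq] at hh
      exact hne (Prod.ext (hf hh.1) (hg hh.2)))
    exact ⟨fun hh => this.1 (by simp [hh]), fun hh => this.2 (by simp [hh])⟩

lemma matching_split {a b : ℕ} {adj : Fin (a+1) → Fin b → Prop}
    {M : Finset (Fin (a+1) × Fin b)} :
    M.card ≤ (Finset.univ.filter (fun e : Fin a × Fin b => (e.1.succ, e.2) ∈ M)).card
      + (M.filter (fun e => e.1 = 0)).card := by
  have h1 : M ⊆ (Finset.univ.filter (fun e : Fin a × Fin b => (e.1.succ, e.2) ∈ M)).image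
      (fun e => (e.1.succ, e.2)) ∪ M.filter (fun e => e.1 = 0) := by
    rintro ⟨i, j⟩ he
    rw [Finset.mem_union]
    rcases Fin.eq_zero_or_eq_succ i with rfl | ⟨i, rfl⟩
    · right; simp [he]
    · left; rw [Finset.mem_image]; exact ⟨(i, j), by simp [he], rfl⟩
  exact (Finset.card_le_card h1).trans ((Finset.card_union_le _ _).trans
    (Nat.add_le_add_right Finset.card_image_le _))

lemma matchingNumber_drop_le {a b : ℕ} (adj : Fin (a+1) → Fin b → Prop) :
    matchingNumber adj ≤ matchingNumber (fun i j => adj (Fin.succ i) j) + 1 := by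
  obtain ⟨M, hM, hc⟩ := exists_matching adj
  have h1 := matching_split (adj := adj) (M := M)
  have h2 := le_matchingNumber (matching_pre (Fin.succ) id (Fin.succ_injective a) Function.injective_id hM)
  have h3 := card_filter_fst_le hM 0
  simp only [id] at h2
  omega

lemma matchingNumber_drop_eq {a b : ℕ} (adj : Fin (a+1) → Fin b → Prop) (h0 : ∀ j, ¬ adj 0 j) :
    matchingNumber adj = matchingNumber (fun i j => adj (Fin.succ i) j) := by
  apply le_antisymm
  · obtain ⟨M, hM, hc⟩ := exists_matching adj
    have h1 := matching_split (adj := adj) (M := M)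
    have h2 := le_matchingNumber (matching_pre (Fin.succ) id (Fin.succ_injective a) Function.injective_id hM)
    have h3 : M.filter (fun e => e.1 = 0) = ∅ := by
      rw [Finset.filter_eq_empty_iff]
      rintro ⟨i, j⟩ he hi
      simp only at hi
      subst hi
      exact h0 j (hM.1 _ he)
    rw [h3] at h1
    simp only [id, Finset.card_empty] at h1 h2
    omega
  · exact matchingNumber_le_of_inj Fin.succ id (Fin.succ_injective a) Function.injective_id (fun i j h => h)

/-- The matching number for given positions. -/
def MM (ρ : ℝ) {a b : ℕ} (S : Fin a → ℝ) (D : Fin b → ℝ) : ℕ :=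
  matchingNumber (fun i j => |S i - D j| ≤ ρ)

lemma MM_swap (ρ : ℝ) {a b : ℕ} (S : Fin a → ℝ) (D : Fin b → ℝ) : MM ρ S D = MM ρ D S := by
  have key : ∀ {a b : ℕ} (S : Fin a → ℝ) (D : Fin b → ℝ), MM ρ S D ≤ MM ρ D S := by
    intro a b S D
    refine (matchingNumber_swap_le _).trans (le_of_eq ?_)
    unfold MM
    congr 1
    funext i j
    rw [abs_sub_comm]
  exact le_antisymm (key _ _) (key _ _)

lemma MM_perm_left (ρ : ℝ) {a b : ℕ} (S : Fin a → ℝ) (D : Fin b → ℝ) (σ : Equiv.Perm (Fin a)) :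
    MM ρ (S ∘ σ) D = MM ρ S D := by
  apply le_antisymm
  · exact matchingNumber_le_of_inj σ id σ.injective Function.injective_id (fun i j h => h)
  · exact matchingNumber_le_of_inj σ.symm id σ.symm.injective Function.injective_id
      (fun i j h => by simpa using h)

lemma MM_insert_left (ρ : ℝ) {a b : ℕ} (S : Fin a → ℝ) (D : Fin b → ℝ) (i : Fin (a+1)) (t : ℝ) :
    MM ρ (Fin.insertNth (α := fun _ => ℝ) i t S) D = MM ρ (Fin.cons t S : Fin (a+1) → ℝ) D := by
  rw [← Fin.cons_comp_cycleRange, MM_perm_left]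

lemma MM_insert_right (ρ : ℝ) {a b : ℕ} (S : Fin a → ℝ) (D : Fin b → ℝ) (i : Fin (b+1)) (t : ℝ) :
    MM ρ S (Fin.insertNth (α := fun _ => ℝ) i t D) = MM ρ S (Fin.cons t D : Fin (b+1) → ℝ) := by
  rw [MM_swap, MM_insert_left, MM_swap]

lemma MM_le_left (ρ : ℝ) {a b : ℕ} (S : Fin a → ℝ) (D : Fin b → ℝ) : MM ρ S D ≤ a :=
  matchingNumber_le_left _

lemma MM_zero_left (ρ : ℝ) {b : ℕ} (S : Fin 0 → ℝ) (D : Fin b → ℝ) : MM ρ S D = 0 :=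
  Nat.le_zero.1 (MM_le_left ρ S D)

lemma MM_zero_right (ρ : ℝ) {b : ℕ} (S : Fin b → ℝ) (D : Fin 0 → ℝ) : MM ρ S D = 0 := by
  rw [MM_swap, MM_zero_left]

lemma MM_cons_le (ρ : ℝ) {a b : ℕ} (t : ℝ) (S : Fin a → ℝ) (D : Fin b → ℝ) :
    MM ρ (Fin.cons t S : Fin (a+1) → ℝ) D ≤ MM ρ S D + 1 := by
  simpa [MM] using matchingNumber_drop_le (fun i j => |(Fin.cons t S : Fin (a+1) → ℝ) i - D j| ≤ ρ)

lemma MM_le_cons (ρ : ℝ) {a b : ℕ} (t : ℝ) (S : Fin a → ℝ) (D : Fin b → ℝ) :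
    MM ρ S D ≤ MM ρ (Fin.cons t S : Fin (a+1) → ℝ) D :=
  matchingNumber_le_of_inj Fin.succ id (Fin.succ_injective a) Function.injective_id
    (fun i j h => by simpa using h)

lemma MM_cons_far (ρ : ℝ) {a b : ℕ} (x : ℝ) (S : Fin a → ℝ) (D : Fin b → ℝ)
    (h : ∀ j, x < D j - ρ) :
    MM ρ (Fin.cons x S : Fin (a+1) → ℝ) D = MM ρ S D := by
  have := matchingNumber_drop_eq (fun i j => |(Fin.cons x S : Fin (a+1) → ℝ) i - D j| ≤ ρ) (by
    intro j hj
    simp only [Fin.cons_zero] at hj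
    have := (abs_le.1 hj).1
    have := h j
    linarith)
  simpa [MM] using this

lemma MM_far_left (ρ : ℝ) (hρ : 0 ≤ ρ) {a b : ℕ} (x y : ℝ) (S : Fin a → ℝ) (D : Fin b → ℝ)
    (h : x < y - ρ) (hD : ∀ j, y ≤ D j) :
    MM ρ (Fin.cons x S : Fin (a+1) → ℝ) (Fin.cons y D : Fin (b+1) → ℝ)
      = MM ρ S (Fin.cons y D : Fin (b+1) → ℝ) := by
  apply MM_cons_far
  intro j
  refine Fin.cases ?_ (fun j => ?_) j
  · simpa using h
  · simp only [Fin.cons_succ]; linarith [hD j]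

lemma MM_far_right (ρ : ℝ) (hρ : 0 ≤ ρ) {a b : ℕ} (x y : ℝ) (S : Fin a → ℝ) (D : Fin b → ℝ)
    (h : y < x - ρ) (hS : ∀ j, x ≤ S j) :
    MM ρ (Fin.cons x S : Fin (a+1) → ℝ) (Fin.cons y D : Fin (b+1) → ℝ)
      = MM ρ (Fin.cons x S : Fin (a+1) → ℝ) D := by
  rw [MM_swap, MM_far_left ρ hρ y x D S h hS, MM_swap]

lemma MM_near (ρ : ℝ) {a b : ℕ} (x y : ℝ) (S : Fin a → ℝ) (D : Fin b → ℝ)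
    (h : |x - y| ≤ ρ) (hS : ∀ i, x ≤ S i) (hD : ∀ j, y ≤ D j) :
    MM ρ (Fin.cons x S : Fin (a+1) → ℝ) (Fin.cons y D : Fin (b+1) → ℝ) = 1 + MM ρ S D := by
  apply le_antisymm
  · obtain ⟨M, hM, hc⟩ := exists_matching
      (fun i j => |(Fin.cons x S : Fin (a+1) → ℝ) i - (Fin.cons y D : Fin (b+1) → ℝ) j| ≤ ρ)
    change M.card = MM ρ (Fin.cons x S : Fin (a+1) → ℝ) (Fin.cons y D : Fin (b+1) → ℝ) at hc
    rw [← hc]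
    set N := Finset.univ.filter (fun e : Fin a × Fin b => (e.1.succ, e.2.succ) ∈ M) with hN
    have hNm : IsBipMatching (fun i j => |S i - D j| ≤ ρ) N := by
      have := matching_pre Fin.succ Fin.succ (Fin.succ_injective a) (Fin.succ_injective b) hM
      simpa using this
    have hA := card_filter_fst_le hM 0
    have hB := card_filter_snd_le hM 0
    have hcov : ∀ e ∈ M, e ∈ N.image (fun e => (e.1.succ, e.2.succ)) ∨ e.1 = 0 ∨ e.2 = 0 := by
      rintro ⟨i, j⟩ he
      rcases Fin.eq_zero_or_eq_succ i with rfl | ⟨i, rfl⟩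
      · simp
      rcases Fin.eq_zero_or_eq_succ j with rfl | ⟨j, rfl⟩
      · simp
      left
      exact Finset.mem_image.2 ⟨(i, j), by simp [hN, he], rfl⟩
    have hNc : (N.image (fun e => (e.1.succ, e.2.succ))).card ≤ N.card := Finset.card_image_le
    have hNle := le_matchingNumber hNm
    change N.card ≤ MM ρ S D at hNle
    by_cases h1 : ∃ j : Fin b, ((0 : Fin (a+1)), j.succ) ∈ M
    · by_cases h2 : ∃ i : Fin a, (i.succ, (0 : Fin (b+1))) ∈ M
      · obtain ⟨j, hj⟩ := h1
        obtain ⟨i, hi⟩ := h2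
        have hcard : M.card ≤ N.card + 1 + 1 := by
          have : M ⊆ (N.image (fun e => (e.1.succ, e.2.succ)) ∪ M.filter (fun e => e.1 = 0))
              ∪ M.filter (fun e => e.2 = 0) := by
            intro e he
            simp only [Finset.mem_union, Finset.mem_filter]
            rcases hcov e he with h | h | h <;> tauto
          refine (Finset.card_le_card this).trans ((Finset.card_union_le _ _).trans ?_)
          refine Nat.add_le_add ((Finset.card_union_le _ _).trans ?_) hB
          omega
        have hij : ∀ e ∈ N, e.1 ≠ i ∧ e.2 ≠ j := by
          intro e he
          have he' : (e.1.succ, e.2.succ) ∈ M := (Finset.mem_filter.1 he).2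
          constructor
          · intro hh
            have := (hM.2 _ he' _ hi (by simp)).1
            simp [hh] at this
          · intro hh
            have := (hM.2 _ he' _ hj (by simp)).2
            simp [hh] at this
        have hnot : (i, j) ∉ N := fun hh => (hij _ hh).1 rfl
        have hnew : IsBipMatching (fun i j => |S i - D j| ≤ ρ) (insert (i, j) N) := by
          refine ⟨?_, ?_⟩
          · intro e he
            rcases Finset.mem_insert.1 he with rfl | he
            · have e1 := abs_le.1 (hM.1 _ hj)
              have e2 := abs_le.1 (hM.1 _ hi)
              simp only [Fin.cons_zero, Fin.cons_succ] at e1 e2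
              have := hS i
              have := hD j
              rw [abs_le]
              constructor <;> simp only <;> linarith
            · exact hNm.1 e he
          · intro e he e' he' hne
            rcases Finset.mem_insert.1 he with rfl | he
            · rcases Finset.mem_insert.1 he' with rfl | he'
              · exact absurd rfl hne
              · exact ⟨(hij _ he').1.symm, (hij _ he').2.symm⟩
            · rcases Finset.mem_insert.1 he' with rfl | he'
              · exact hij _ he
              · exact hNm.2 e he e' he' hne
        have := le_matchingNumber hnew
        rw [Finset.card_insert_of_notMem hnot] at this
        change N.card + 1 ≤ MM ρ S D at this
        omega
      · have : M ⊆ N.image (fun e => (e.1.succ, e.2.succ)) ∪ M.filter (fun e => e.1 = 0) := by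
          rintro ⟨i, j⟩ he
          simp only [Finset.mem_union, Finset.mem_filter]
          rcases hcov _ he with h | h | h
          · tauto
          · tauto
          · simp only at h
            subst h
            rcases Fin.eq_zero_or_eq_succ i with rfl | ⟨i, rfl⟩
            · tauto
            · exact absurd ⟨i, he⟩ h2
        have := (Finset.card_le_card this).trans (Finset.card_union_le _ _)
        omega
    · have : M ⊆ N.image (fun e => (e.1.succ, e.2.succ)) ∪ M.filter (fun e => e.2 = 0) := by
        rintro ⟨i, j⟩ he
        simp only [Finset.mem_union, Finset.mem_filter]
        rcases hcov _ he with h | h | h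
        · tauto
        · simp only at h
          subst h
          rcases Fin.eq_zero_or_eq_succ j with rfl | ⟨j, rfl⟩
          · tauto
          · exact absurd ⟨j, he⟩ h1
        · tauto
      have := (Finset.card_le_card this).trans (Finset.card_union_le _ _)
      omega
  · obtain ⟨M, hM, hc⟩ := exists_matching (fun i j => |S i - D j| ≤ ρ)
    change M.card = MM ρ S D at hc
    have hinj : Function.Injective (fun e : Fin a × Fin b => (e.1.succ, e.2.succ)) := by
      rintro ⟨i, j⟩ ⟨i', j'⟩ h
      simpa using h
    have hnot : ((0 : Fin (a+1)), (0 : Fin (b+1))) ∉ M.image (fun e => (e.1.succ, e.2.succ)) := by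
      simp
    have hmat : IsBipMatching
        (fun i j => |(Fin.cons x S : Fin (a+1) → ℝ) i - (Fin.cons y D : Fin (b+1) → ℝ) j| ≤ ρ)
        (insert (0, 0) (M.image (fun e => (e.1.succ, e.2.succ)))) := by
      refine ⟨?_, ?_⟩
      · intro e he
        rcases Finset.mem_insert.1 he with rfl | he
        · simpa using h
        · obtain ⟨e0, he0, rfl⟩ := Finset.mem_image.1 he
          simpa using hM.1 e0 he0
      · intro e he e' he' hne
        rcases Finset.mem_insert.1 he with rfl | he
        · rcases Finset.mem_insert.1 he' with rfl | he'
          · exact absurd rfl hne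
          · obtain ⟨e, he, rfl⟩ := Finset.mem_image.1 he'
            exact ⟨(Fin.succ_ne_zero _).symm, (Fin.succ_ne_zero _).symm⟩
        · obtain ⟨e0, he0, rfl⟩ := Finset.mem_image.1 he
          rcases Finset.mem_insert.1 he' with rfl | he'
          · exact ⟨(Fin.succ_ne_zero _), (Fin.succ_ne_zero _)⟩
          · obtain ⟨e1, he1, rfl⟩ := Finset.mem_image.1 he'
            have := hM.2 e0 he0 e1 he1 (fun hh => hne (by rw [hh]))
            exact ⟨fun hh => this.1 (Fin.succ_injective _ hh), fun hh => this.2 (Fin.succ_injective _ hh)⟩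
    have := le_matchingNumber hmat
    rw [Finset.card_insert_of_notMem hnot, Finset.card_image_of_injective _ hinj] at this
    change M.card + 1 ≤ MM ρ (Fin.cons x S : Fin (a+1) → ℝ) (Fin.cons y D : Fin (b+1) → ℝ) at this
    omega

lemma measurable_MM (ρ : ℝ) (a b : ℕ) :
    Measurable (fun q : (Fin a → ℝ) × (Fin b → ℝ) => MM ρ q.1 q.2) := by
  have h1 : Measurable (fun adj : Fin a → Fin b → Prop => matchingNumber adj) := Measurable.of_discrete
  have h2 : Measurable (fun q : (Fin a → ℝ) × (Fin b → ℝ) => (fun (i : Fin a) (j : Fin b) => |q.1 i - q.2 j| ≤ ρ)) := by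
    refine measurable_pi_lambda _ (fun i => measurable_pi_lambda _ (fun j => ?_))
    apply measurableSet_setOfPred.1
    apply measurableSet_le <;> fun_prop
  exact h1.comp h2

/-- The box `[x,1]^a`. -/
def box (a : ℕ) (x : ℝ) : Set (Fin a → ℝ) := Set.univ.pi (fun _ => Set.Icc x 1)

/-- The Poisson weight. -/
def cc (lam x : ℝ) (a : ℕ) : ENNReal :=
  ENNReal.ofReal (Real.exp (-(lam * (1 - x))) * lam ^ a / a.factorial)

/-- Expectation over a Poisson process of rate `lam` on `[x,1]`. -/
def PP (lam x : ℝ) (G : ∀ a : ℕ, (Fin a → ℝ) → ENNReal) : ENNReal :=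
  ∑' a, cc lam x a * ∫⁻ z in box a x, G a z

lemma measurableSet_box (a : ℕ) (x : ℝ) : MeasurableSet (box a x) :=
  MeasurableSet.univ_pi (fun _ => measurableSet_Icc)

lemma mem_box {a : ℕ} {x : ℝ} {z : Fin a → ℝ} : z ∈ box a x ↔ ∀ i, x ≤ z i ∧ z i ≤ 1 := by
  rw [box, Set.mem_univ_pi]; rfl

lemma measurable_cc (lam : ℝ) (a : ℕ) : Measurable (fun x => cc lam x a) := by
  unfold cc
  fun_prop

lemma measurable_box_lintegral {α : Type*} [MeasurableSpace α] (x : α → ℝ)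
    (hx : Measurable x) (a : ℕ) (G : α → (Fin a → ℝ) → ENNReal)
    (hG : Measurable (fun q : α × (Fin a → ℝ) => G q.1 q.2)) :
    Measurable (fun ω => ∫⁻ z in box a (x ω), G ω z) := by
  have : ∀ ω, ∫⁻ z in box a (x ω), G ω z
      = ∫⁻ z, ({q : α × (Fin a → ℝ) | ∀ i, x q.1 ≤ q.2 i ∧ q.2 i ≤ 1}.indicator
          (fun q => G q.1 q.2)) (ω, z) := by
    intro ω
    rw [← lintegral_indicator (measurableSet_box a (x ω))]
    congr 1
    funext z
    simp only [Set.indicator, mem_box, Set.mem_ofPred_eq]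
  simp_rw [this]
  apply Measurable.lintegral_prod_right' (f := fun q => ({q : α × (Fin a → ℝ) | ∀ i, x q.1 ≤ q.2 i ∧ q.2 i ≤ 1}.indicator
          (fun q => G q.1 q.2)) q)
  apply hG.indicator
  refine measurableSet_setOfPred.2 (Measurable.forall fun i => ?_)
  refine Measurable.and (measurableSet_setOfPred.1 ?_) (measurableSet_setOfPred.1 ?_)
  · apply measurableSet_le <;> fun_prop
  · apply measurableSet_le <;> fun_prop

lemma measurable_PP {α : Type*} [MeasurableSpace α] (lam : ℝ) (x : α → ℝ)
    (hx : Measurable x) (G : ∀ a : ℕ, α → (Fin a → ℝ) → ENNReal)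
    (hG : ∀ a, Measurable (fun q : α × (Fin a → ℝ) => G a q.1 q.2)) :
    Measurable (fun ω => PP lam (x ω) (fun a => G a ω)) := by
  unfold PP
  apply Measurable.ennreal_tsum
  intro a
  exact ((measurable_cc lam a).comp hx).mul (measurable_box_lintegral x hx a _ (hG a))

lemma first_point (a : ℕ) (x : ℝ) (G : (Fin (a+1) → ℝ) → ENNReal) (hG : Measurable G)
    (hs : ∀ i t z, G (Fin.insertNth (α := fun _ => ℝ) i t z) = G (Fin.cons t z)) :
    ∫⁻ z in box (a+1) x, G z
      = (a + 1 : ℕ) * ∫⁻ t in Set.Icc x 1, ∫⁻ z in box a t, G (Fin.cons t z) := by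
  let E : Fin (a+1) → Set (Fin (a+1) → ℝ) := fun i =>
    {z | (x ≤ z i ∧ z i ≤ 1) ∧ ∀ j, z (i.succAbove j) ≤ 1 ∧
      (if i.succAbove j < i then z i < z (i.succAbove j) else z i ≤ z (i.succAbove j))}
  have hE : ∀ i, MeasurableSet (E i) := by
    intro i
    refine measurableSet_setOfPred.2 (Measurable.and (Measurable.and
      (measurableSet_setOfPred.1 ?_) (measurableSet_setOfPred.1 ?_))
      (Measurable.forall fun j => Measurable.and (measurableSet_setOfPred.1 ?_)
        (measurableSet_setOfPred.1 ?_)))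
    · apply measurableSet_le <;> fun_prop
    · apply measurableSet_le <;> fun_prop
    · apply measurableSet_le <;> fun_prop
    · by_cases h : i.succAbove j < i
      · simp only [h, if_true]
        apply measurableSet_lt <;> fun_prop
      · simp only [h, if_false]
        apply measurableSet_le <;> fun_prop
  have hE' : ∀ i z, z ∈ E i ↔ (x ≤ z i ∧ z i ≤ 1) ∧ ∀ k, k ≠ i → z k ≤ 1 ∧
      (if k < i then z i < z k else z i ≤ z k) := by
    intro i z
    constructor
    · rintro ⟨h1, h2⟩
      refine ⟨h1, fun k hk => ?_⟩
      obtain ⟨j, rfl⟩ := Fin.exists_succAbove_eq hk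
      exact h2 j
    · rintro ⟨h1, h2⟩
      exact ⟨h1, fun j => h2 _ (Fin.succAbove_ne i j)⟩
  have hU : box (a+1) x = ⋃ i, E i := by
    ext z
    simp only [mem_box, Set.mem_iUnion, hE']
    constructor
    · intro h
      obtain ⟨i0, hi0⟩ := Finite.exists_min z
      have hne : (Finset.univ.filter (fun i => ∀ k, z i ≤ z k)).Nonempty := ⟨i0, by simpa using hi0⟩
      refine ⟨Finset.min' _ hne, h _, ?_⟩
      · intro k hk
        have hm := Finset.min'_mem _ hne
        rw [Finset.mem_filter] at hm
        refine ⟨(h k).2, ?_⟩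
        split_ifs with hlt
        · by_contra hcon
          push Not at hcon
          have : k ∈ Finset.univ.filter (fun i => ∀ k, z i ≤ z k) := by
            simp only [Finset.mem_filter, Finset.mem_univ, true_and]
            intro l
            exact hcon.trans (hm.2 l)
          exact absurd (Finset.min'_le _ _ this) (not_le.2 hlt)
        · exact hm.2 k
    · rintro ⟨i, h1, h2⟩ k
      by_cases hk : k = i
      · subst hk; exact h1
      · have := h2 k hk
        refine ⟨?_, this.1⟩
        have h3 := this.2
        split_ifs at h3
        · exact h1.1.trans h3.le
        · exact h1.1.trans h3
  have hdis : Pairwise (Function.onFun Disjoint E) := by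
    have key : ∀ i k : Fin (a+1), i < k → Disjoint (E i) (E k) := by
      intro i k hik
      rw [Set.disjoint_left]
      intro z hz hz'
      rw [hE'] at hz hz'
      have h1 := (hz.2 k hik.ne').2
      have h2 := (hz'.2 i hik.ne).2
      rw [if_neg (not_lt.2 hik.le)] at h1
      rw [if_pos hik] at h2
      linarith
    intro i k hik
    rcases lt_or_gt_of_ne hik with h | h
    · exact key i k h
    · exact (key k i h).symm
  have hI : ∀ i, ∫⁻ z in E i, G z = ∫⁻ t in Set.Icc x 1, ∫⁻ z in box a t, G (Fin.cons t z) := by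
    intro i
    rw [← lintegral_indicator (hE i)]
    have hmp := (volume_preserving_piFinSuccAbove (fun _ : Fin (a + 1) => ℝ) i).symm
    rw [← hmp.lintegral_comp (hG.indicator (hE i))]
    rw [Measure.volume_eq_prod, lintegral_prod _ (by
      apply Measurable.aemeasurable
      exact (hG.indicator (hE i)).comp (MeasurableEquiv.measurable _))]
    rw [← lintegral_indicator measurableSet_Icc]
    congr 1
    funext t
    have hins : ∀ z : Fin a → ℝ, (MeasurableEquiv.piFinSuccAbove (fun _ : Fin (a + 1) => ℝ) i).symm (t, z)
        = Fin.insertNth (α := fun _ => ℝ) i t z := fun z => rfl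
    simp_rw [hins]
    by_cases ht : t ∈ Set.Icc x 1
    · rw [Set.indicator_of_mem ht]
      let s : Fin a → Set ℝ := fun j => if i.succAbove j < i then Set.Ioc t 1 else Set.Icc t 1
      have hs1 : ∀ z : Fin a → ℝ, Set.indicator (E i) G (Fin.insertNth (α := fun _ => ℝ) i t z)
          = (Set.univ.pi s).indicator (fun z => G (Fin.cons t z)) z := by
        intro z
        have : Fin.insertNth (α := fun _ => ℝ) i t z ∈ E i ↔ z ∈ Set.univ.pi s := by
          simp only [E, Set.mem_ofPred_eq, Fin.insertNth_apply_same, Fin.insertNth_apply_succAbove,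
            Set.mem_univ_pi, s]
          constructor
          · rintro ⟨-, h⟩ j
            have := h j
            split_ifs at this ⊢
            · exact ⟨this.2, this.1⟩
            · exact ⟨this.2, this.1⟩
          · intro h
            refine ⟨ht, fun j => ?_⟩
            have := h j
            split_ifs at this ⊢
            · exact ⟨this.2, this.1⟩
            · exact ⟨this.2, this.1⟩
        by_cases hz : z ∈ Set.univ.pi s
        · rw [Set.indicator_of_mem hz, Set.indicator_of_mem (this.2 hz), hs]
        · rw [Set.indicator_of_notMem hz, Set.indicator_of_notMem (fun h => hz (this.1 h))]
      simp_rw [hs1]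
      rw [lintegral_indicator]
      · apply setLIntegral_congr
        apply Measure.ae_eq_set_pi
        intro j _
        simp only [s]
        split_ifs
        · exact Ioc_ae_eq_Icc
        · exact Filter.EventuallyEq.rfl
      · apply MeasurableSet.univ_pi
        intro j
        simp only [s]
        split_ifs
        · exact measurableSet_Ioc
        · exact measurableSet_Icc
    · rw [Set.indicator_of_notMem ht]
      have : ∀ z : Fin a → ℝ, Set.indicator (E i) G (Fin.insertNth (α := fun _ => ℝ) i t z) = 0 := by
        intro z
        apply Set.indicator_of_notMem
        rintro ⟨h, -⟩
        simp only [Fin.insertNth_apply_same] at h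
        exact ht h
      simp [this]
  rw [hU, lintegral_iUnion hE hdis, tsum_fintype]
  simp_rw [hI]
  simp

lemma measurable_cons (a : ℕ) : Measurable (fun q : ℝ × (Fin a → ℝ) => (Fin.cons q.1 q.2 : Fin (a+1) → ℝ)) := by
  refine measurable_pi_lambda _ (fun i => ?_)
  refine Fin.cases ?_ (fun i => ?_) i
  · simpa using measurable_fst
  · simp only [Fin.cons_succ]; fun_prop

/-- exponential weight -/
def ww (lam x t : ℝ) : ℝ := lam * Real.exp (-(lam * (t - x)))

lemma measurable_ww (lam x : ℝ) : Measurable (ww lam x) := by unfold ww; fun_prop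

lemma PP_first (lam : ℝ) (hl : 0 ≤ lam) (x : ℝ) (G : ∀ a : ℕ, (Fin a → ℝ) → ENNReal)
    (hG : ∀ a, Measurable (G a)) (hG0 : ∀ z, G 0 z = 0)
    (hs : ∀ a (i : Fin (a+1)) t z, G (a+1) (Fin.insertNth (α := fun _ => ℝ) i t z) = G (a+1) (Fin.cons t z)) :
    PP lam x G = ∫⁻ t in Set.Icc x 1, ENNReal.ofReal (ww lam x t) *
      PP lam t (fun a z => G (a+1) (Fin.cons t z)) := by
  have hmeas : ∀ a, Measurable (fun t : ℝ => ∫⁻ z in box a t, G (a+1) (Fin.cons t z)) := by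
    intro a
    exact measurable_box_lintegral (fun t => t) measurable_id a (fun t z => G (a+1) (Fin.cons t z))
      ((hG (a+1)).comp (measurable_cons a))
  unfold PP
  rw [tsum_eq_zero_add' ENNReal.summable]
  simp_rw [← ENNReal.tsum_mul_left]
  rw [lintegral_tsum]
  · simp only [hG0, lintegral_zero, mul_zero, zero_add]
    congr 1
    funext a
    rw [first_point a x _ (hG (a+1)) (hs a), ← mul_assoc, ← lintegral_const_mul _ (hmeas a)]
    congr 1
    funext t
    rw [← mul_assoc]
    congr 1
    rw [cc, cc, ww, ← ENNReal.ofReal_natCast, ← ENNReal.ofReal_mul (by positivity), ← ENNReal.ofReal_mul (by positivity)]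
    congr 1
    have : Real.exp (-(lam * (1 - x))) = Real.exp (-(lam * (t - x))) * Real.exp (-(lam * (1 - t))) := by
      rw [← Real.exp_add]; congr 1; ring
    rw [this, Nat.factorial_succ]
    push_cast
    field_simp
    ring
  · intro a
    apply Measurable.aemeasurable
    exact (measurable_ww lam x).ennreal_ofReal.mul ((measurable_cc lam a).mul (hmeas a))

lemma PP_swap (lam x y : ℝ) (w : ℝ → ENNReal) (hw : Measurable w)
    (F : ∀ a : ℕ, (Fin a → ℝ) → ℝ → ENNReal)
    (hF : ∀ a, Measurable (fun q : (Fin a → ℝ) × ℝ => F a q.1 q.2)) :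
    PP lam x (fun a z => ∫⁻ t in Set.Icc y 1, w t * F a z t)
      = ∫⁻ t in Set.Icc y 1, w t * PP lam x (fun a z => F a z t) := by
  have hm : ∀ a, Measurable (fun t => ∫⁻ z in box a x, F a z t) := by
    intro a
    exact measurable_box_lintegral (fun _ => x) measurable_const a (fun t z => F a z t)
      ((hF a).comp measurable_swap)
  unfold PP
  simp_rw [← ENNReal.tsum_mul_left]
  rw [lintegral_tsum]
  · congr 1
    funext a
    rw [lintegral_lintegral_swap]
    · rw [← lintegral_const_mul]
      · congr 1
        funext t
        have hh : Measurable (fun z => F a z t) := (hF a).comp (measurable_id.prodMk measurable_const)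
        rw [lintegral_const_mul _ hh]
        ring
      · have : ∀ t, ∫⁻ z in box a x, w t * F a z t = w t * ∫⁻ z in box a x, F a z t := fun t =>
          lintegral_const_mul _ ((hF a).comp (measurable_id.prodMk measurable_const))
        simp_rw [this]
        exact hw.mul (hm a)
    · apply Measurable.aemeasurable
      exact (hw.comp measurable_snd).mul (hF a)
  · intro a
    exact (hw.mul (measurable_const.mul (hm a))).aemeasurable

lemma PP_congr (lam x : ℝ) {G G' : ∀ a : ℕ, (Fin a → ℝ) → ENNReal}
    (h : ∀ a, ∀ z ∈ box a x, G a z = G' a z) : PP lam x G = PP lam x G' := by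
  unfold PP
  congr 1
  funext a
  rw [setLIntegral_congr_fun (measurableSet_box a x) (h a)]

lemma PP_mono (lam x : ℝ) {G G' : ∀ a : ℕ, (Fin a → ℝ) → ENNReal}
    (h : ∀ a, ∀ z ∈ box a x, G a z ≤ G' a z) : PP lam x G ≤ PP lam x G' := by
  unfold PP
  refine ENNReal.tsum_le_tsum (fun a => mul_le_mul_right ?_ _)
  exact setLIntegral_mono' (measurableSet_box a x) (h a)

lemma volume_box (a : ℕ) (x : ℝ) (hx : x ≤ 1) : volume (box a x) = ENNReal.ofReal ((1 - x) ^ a) := by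
  rw [box, volume_pi_pi]
  simp [ENNReal.ofReal_pow (sub_nonneg.2 hx)]

lemma PP_pow (lam x : ℝ) (hl : 0 ≤ lam) (hx : x ≤ 1) (k : ℝ) (hk : 0 ≤ k) :
    PP lam x (fun a _ => ENNReal.ofReal (k ^ a)) = ENNReal.ofReal (Real.exp ((k - 1) * (lam * (1 - x)))) := by
  unfold PP
  have h1x : 0 ≤ 1 - x := sub_nonneg.2 hx
  have : ∀ a, cc lam x a * ∫⁻ z in box a x, ENNReal.ofReal (k ^ a)
      = ENNReal.ofReal (Real.exp (-(lam * (1 - x))) * ((k * (lam * (1 - x))) ^ a / a.factorial)) := by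
    intro a
    rw [setLIntegral_const, volume_box a x hx, cc, ← ENNReal.ofReal_mul (by positivity),
      ← ENNReal.ofReal_mul (by positivity)]
    congr 1
    rw [mul_pow, mul_pow]
    ring
  simp_rw [this]
  have hsum := (NormedSpace.expSeries_div_hasSum_exp (k * (lam * (1 - x)))).mul_left (Real.exp (-(lam * (1 - x))))
  rw [← ENNReal.ofReal_tsum_of_nonneg (fun a => by positivity) hsum.summable, hsum.tsum_eq,
    ← Real.exp_eq_exp_ℝ, ← Real.exp_add]
  congr 2
  ring

lemma PP_one (lam x : ℝ) (hl : 0 ≤ lam) (hx : x ≤ 1) : PP lam x (fun _ _ => 1) = 1 := by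
  have := PP_pow lam x hl hx 1 zero_le_one
  simpa using this

lemma PP_one_add (lam x : ℝ) (hl : 0 ≤ lam) (hx : x ≤ 1) (G : ∀ a : ℕ, (Fin a → ℝ) → ENNReal) :
    PP lam x (fun a z => 1 + G a z) = 1 + PP lam x G := by
  have h1 := PP_one lam x hl hx
  unfold PP at h1 ⊢
  nth_rw 2 [← h1]
  rw [← ENNReal.tsum_add]
  congr 1
  funext a
  rw [lintegral_add_left measurable_const, mul_add]

lemma meas_MM {α : Type*} [MeasurableSpace α] (ρ : ℝ) {a b : ℕ} {S : α → Fin a → ℝ}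
    {D : α → Fin b → ℝ} (hS : Measurable S) (hD : Measurable D) :
    Measurable (fun ω => ((MM ρ (S ω) (D ω) : ℕ) : ENNReal)) :=
  (Measurable.of_discrete (f := fun k : ℕ => (k : ENNReal))).comp
    ((measurable_MM ρ a b).comp (hS.prodMk hD))

lemma meas_cons {α : Type*} [MeasurableSpace α] {a : ℕ} {x : α → ℝ} {S : α → Fin a → ℝ}
    (hx : Measurable x) (hS : Measurable S) :
    Measurable (fun ω => (Fin.cons (x ω) (S ω) : Fin (a+1) → ℝ)) :=
  (measurable_cons a).comp (hx.prodMk hS)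

/-- expected matching number given heads `x`, `y` and Poisson points beyond -/
def mE (lam ρ x y : ℝ) : ENNReal :=
  PP lam x (fun a S => PP lam y (fun b D =>
    ((MM ρ (Fin.cons x S : Fin (a+1) → ℝ) (Fin.cons y D : Fin (b+1) → ℝ) : ℕ) : ENNReal)))

/-- expected matching number of Poisson points -/
def AE (lam ρ x y : ℝ) : ENNReal :=
  PP lam x (fun a S => PP lam y (fun b D => ((MM ρ S D : ℕ) : ENNReal)))

lemma mE_near (lam ρ x y : ℝ) (hl : 0 ≤ lam) (hx : x ≤ 1) (hy : y ≤ 1) (h : |x - y| ≤ ρ) :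
    mE lam ρ x y = 1 + AE lam ρ x y := by
  unfold mE AE
  rw [← PP_one_add lam x hl hx]
  apply PP_congr
  intro a S hS
  rw [← PP_one_add lam y hl hy]
  apply PP_congr
  intro b D hD
  rw [MM_near ρ x y S D h (fun i => (mem_box.1 hS i).1) (fun i => (mem_box.1 hD i).1)]
  push_cast
  rfl

/-- half-revealed step on the demand side -/
lemma PP_demand (lam ρ : ℝ) (hl : 0 ≤ lam) (y : ℝ) {a : ℕ} (S : Fin a → ℝ) :
    PP lam y (fun b D => ((MM ρ S D : ℕ) : ENNReal))
      = ∫⁻ d in Set.Icc y 1, ENNReal.ofReal (ww lam y d) *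
        PP lam d (fun b D => ((MM ρ S (Fin.cons d D : Fin (b+1) → ℝ) : ℕ) : ENNReal)) := by
  apply PP_first lam hl y (fun b D => ((MM ρ S D : ℕ) : ENNReal))
  · intro b
    exact meas_MM ρ measurable_const measurable_id
  · intro z; simp [MM_zero_right]
  · intro b i t z
    simp only [MM_insert_right]

lemma meas_inner (lam ρ : ℝ) {α : Type*} [MeasurableSpace α] {a : ℕ} {S : α → Fin a → ℝ} {d : α → ℝ}
    (hS : Measurable S) (hd : Measurable d) :
    Measurable (fun ω => PP lam (d ω)
      (fun b D => ((MM ρ (S ω) (Fin.cons (d ω) D : Fin (b+1) → ℝ) : ℕ) : ENNReal))) := by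
  apply measurable_PP lam d hd (fun b ω D => ((MM ρ (S ω) (Fin.cons (d ω) D : Fin (b+1) → ℝ) : ℕ) : ENNReal))
  intro b
  exact meas_MM ρ (hS.comp measurable_fst) (meas_cons (hd.comp measurable_fst) measurable_snd)

lemma measurable_mE (lam ρ : ℝ) : Measurable (fun q : ℝ × ℝ => mE lam ρ q.1 q.2) := by
  unfold mE
  apply measurable_PP lam (fun q : ℝ × ℝ => q.1) measurable_fst (fun a q S => PP lam q.2 (fun b D =>
    ((MM ρ (Fin.cons q.1 S : Fin (a+1) → ℝ) (Fin.cons q.2 D : Fin (b+1) → ℝ) : ℕ) : ENNReal)))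
  intro a
  exact meas_inner lam ρ (S := fun q : (ℝ × ℝ) × (Fin a → ℝ) => (Fin.cons q.1.1 q.2 : Fin (a+1) → ℝ))
    (d := fun q => q.1.2) (meas_cons (by fun_prop) (by fun_prop)) (by fun_prop)

lemma mE_left (lam ρ x y : ℝ) (hl : 0 ≤ lam) (hρ : 0 ≤ ρ) (h : x < y - ρ) :
    mE lam ρ x y = ∫⁻ s in Set.Icc x 1, ENNReal.ofReal (ww lam x s) * mE lam ρ s y := by
  have : mE lam ρ x y = PP lam x (fun a S => PP lam y (fun b D =>
      ((MM ρ S (Fin.cons y D : Fin (b+1) → ℝ) : ℕ) : ENNReal))) := by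
    apply PP_congr
    intro a S hS
    apply PP_congr
    intro b D hD
    rw [MM_far_left ρ hρ x y S D h (fun i => (mem_box.1 hD i).1)]
  rw [this, PP_first lam hl x]
  · rfl
  · intro a
    exact meas_inner lam ρ measurable_id measurable_const
  · intro z
    simp [MM_zero_left, PP]
  · intro a i t z
    simp only [MM_insert_left]

lemma mE_right (lam ρ x y : ℝ) (hl : 0 ≤ lam) (hρ : 0 ≤ ρ) (h : y < x - ρ) :
    mE lam ρ x y = ∫⁻ d in Set.Icc y 1, ENNReal.ofReal (ww lam y d) * mE lam ρ x d := by
  have : mE lam ρ x y = PP lam x (fun a S => PP lam y (fun b D =>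
      ((MM ρ (Fin.cons x S : Fin (a+1) → ℝ) D : ℕ) : ENNReal))) := by
    apply PP_congr
    intro a S hS
    apply PP_congr
    intro b D hD
    rw [MM_far_right ρ hρ x y S D h (fun i => (mem_box.1 hS i).1)]
  rw [this]
  simp_rw [PP_demand lam ρ hl y]
  rw [PP_swap lam x y _ (measurable_ww lam y).ennreal_ofReal]
  · rfl
  · intro a
    exact meas_inner lam ρ (meas_cons measurable_const measurable_fst) measurable_snd

lemma AE_eq (lam ρ x y : ℝ) (hl : 0 ≤ lam) :
    AE lam ρ x y = ∫⁻ s in Set.Icc x 1, ENNReal.ofReal (ww lam x s) *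
      ∫⁻ d in Set.Icc y 1, ENNReal.ofReal (ww lam y d) * mE lam ρ s d := by
  unfold AE
  rw [PP_first lam hl x]
  · congr 1
    funext s
    congr 1
    simp_rw [PP_demand lam ρ hl y]
    rw [PP_swap lam s y _ (measurable_ww lam y).ennreal_ofReal]
    · rfl
    · intro a
      exact meas_inner lam ρ (meas_cons measurable_const measurable_fst) measurable_snd
  · intro a
    apply measurable_PP lam (fun _ => y) measurable_const (fun b (S : Fin a → ℝ) D => ((MM ρ S D : ℕ) : ENNReal))
    intro b
    exact meas_MM ρ measurable_fst measurable_snd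
  · intro z
    simp [MM_zero_left, PP]
  · intro a i t z
    simp only [MM_insert_left]

lemma mE_le (lam ρ x y : ℝ) (hl : 0 ≤ lam) (hx0 : 0 ≤ x) (hx : x ≤ 1) (hy : y ≤ 1) :
    mE lam ρ x y ≤ ENNReal.ofReal (Real.exp lam) := by
  calc mE lam ρ x y ≤ PP lam x (fun a _ => ENNReal.ofReal ((2:ℝ) ^ a)) := by
        apply PP_mono
        intro a S hS
        calc _ ≤ PP lam y (fun b _ => ((a + 1 : ℕ) : ENNReal)) := by
              apply PP_mono
              intro b D hD
              exact Nat.cast_le.2 (MM_le_left ρ _ _)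
          _ = ((a+1 : ℕ) : ENNReal) := by
              have := PP_one lam y hl hy
              unfold PP at this ⊢
              simp only [lintegral_const, one_mul] at this ⊢
              have h2 : ∀ b, cc lam y b * (((a+1 : ℕ) : ENNReal) * (volume.restrict (box b y)) Set.univ)
                = ((a+1 : ℕ) : ENNReal) * (cc lam y b * (volume.restrict (box b y)) Set.univ) := by
                intro b; ring
              simp_rw [h2]
              rw [ENNReal.tsum_mul_left, this, mul_one]
          _ ≤ _ := by
              rw [← ENNReal.ofReal_natCast]
              apply ENNReal.ofReal_le_ofReal
              exact_mod_cast Nat.lt_two_pow_self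
    _ = _ := PP_pow lam x hl hx 2 zero_le_two
    _ ≤ _ := by
      apply ENNReal.ofReal_le_ofReal
      apply Real.exp_le_exp.2
      nlinarith

/-- clamp to `[-r,r]` -/
def cl (r z : ℝ) : ℝ := max (-r) (min r z)

/-- potential -/
def hh (r z : ℝ) : ℝ := -1 - (z * cl r z - cl r z ^ 2 / 2)

def DD (lam r x y : ℝ) : ℝ :=
  r * (2 + lam * (2 - x - y)) + hh r (lam * (x - y)) + (if |lam * (x - y)| ≤ r then 1 else 0)

def G1 (lam r x y : ℝ) : ℝ :=
  r * (1 + lam * (2 - x - y)) + hh r (lam * (x - y)) + cl r (lam * (x - y))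

def G2 (lam r x y : ℝ) : ℝ := r * (lam * (2 - x - y)) + hh r (lam * (x - y))

lemma cl_neg (r z : ℝ) (hr : 0 ≤ r) : cl r (-z) = -cl r z := by
  unfold cl
  rcases le_total r z with h | h <;> rcases le_total (-r) z with h' | h' <;>
  rcases le_total r (-z) with h2 | h2 <;> rcases le_total (-r) (-z) with h3 | h3 <;>
  simp [max_def, min_def] <;> split_ifs <;> linarith

lemma hh_neg (r z : ℝ) (hr : 0 ≤ r) : hh r (-z) = hh r z := by
  unfold hh
  rw [cl_neg r z hr]; ring

lemma cl_cont (r : ℝ) : Continuous (cl r) := by unfold cl; fun_prop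
lemma hh_cont (r : ℝ) : Continuous (hh r) := by
  have := cl_cont r
  unfold hh; fun_prop

lemma cl_abs (r z : ℝ) (hr : 0 ≤ r) : |cl r z| ≤ r := by
  unfold cl
  rw [abs_le]
  exact ⟨le_max_left _ _, max_le (by linarith) (min_le_left _ _)⟩

lemma DD_symm (lam r x y : ℝ) (hr : 0 ≤ r) : DD lam r x y = DD lam r y x := by
  unfold DD
  have : lam * (x - y) = -(lam * (y - x)) := by ring
  rw [this, hh_neg r _ hr, abs_neg]
  ring

lemma G2_symm (lam r x y : ℝ) (hr : 0 ≤ r) : G2 lam r x y = G2 lam r y x := by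
  unfold G2
  have : lam * (x - y) = -(lam * (y - x)) := by ring
  rw [this, hh_neg r _ hr]
  ring

lemma cl_of_lt (r z : ℝ) (hr : 0 ≤ r) (h : z ≤ -r) : cl r z = -r := by
  unfold cl; rw [min_eq_right (by linarith), max_eq_left h]
lemma cl_of_gt (r z : ℝ) (hr : 0 ≤ r) (h : r ≤ z) : cl r z = r := by
  unfold cl; rw [min_eq_left h, max_eq_right (by linarith)]
lemma cl_of_mid (r z : ℝ) (h : |z| ≤ r) : cl r z = z := by
  unfold cl; rw [min_eq_right (abs_le.1 h).2, max_eq_right (abs_le.1 h).1]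

lemma cl_deriv (r z : ℝ) (hr : 0 ≤ r) (h1 : z ≠ r) (h2 : z ≠ -r) :
    HasDerivAt (cl r) (if |z| ≤ r then 1 else 0) z := by
  rcases lt_or_gt_of_ne h2 with h | h
  · have : ¬ |z| ≤ r := fun hh => by have := (abs_le.1 hh).1; linarith
    rw [if_neg this]
    refine (hasDerivAt_const z (-r)).congr_of_eventuallyEq ?_
    filter_upwards [Iio_mem_nhds h] with w hw
    exact cl_of_lt r w hr (le_of_lt hw)
  rcases lt_or_gt_of_ne h1 with h' | h'
  · rw [if_pos (abs_le.2 ⟨h.le, h'.le⟩)]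
    refine (hasDerivAt_id z).congr_of_eventuallyEq ?_
    filter_upwards [Ioo_mem_nhds h h'] with w hw
    exact cl_of_mid r w (abs_le.2 ⟨hw.1.le, hw.2.le⟩)
  · have : ¬ |z| ≤ r := fun hh => by have := (abs_le.1 hh).2; linarith
    rw [if_neg this]
    refine (hasDerivAt_const z r).congr_of_eventuallyEq ?_
    filter_upwards [Ioi_mem_nhds h'] with w hw
    exact cl_of_gt r w hr (le_of_lt hw)

lemma hh_deriv (r z : ℝ) (hr : 0 ≤ r) (h1 : z ≠ r) (h2 : z ≠ -r) :
    HasDerivAt (hh r) (-cl r z) z := by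
  have hc := cl_deriv r z hr h1 h2
  have := (((hasDerivAt_id z).mul hc).sub ((hc.pow 2).div_const 2)).const_sub (-1)
  refine (this.congr_deriv ?_)
  simp only [id]
  split_ifs with h
  · rw [cl_of_mid r z h]; norm_num
  · norm_num

lemma ww_cont (lam x : ℝ) : Continuous (ww lam x) := by unfold ww; fun_prop

lemma exp_deriv (lam y d : ℝ) : HasDerivAt (fun d => Real.exp (-(lam * (d - y))))
    (-(ww lam y d)) d := by
  have h1 : HasDerivAt (fun d => -(lam * (d - y))) (-lam) d := by
    have := ((((hasDerivAt_id d).sub_const y).const_mul lam)).neg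
    exact this.congr_deriv (by simp)
  refine h1.exp.congr_deriv ?_
  unfold ww; ring

lemma int_ww (lam y : ℝ) : ∫ d in y..1, ww lam y d = 1 - Real.exp (-(lam * (1 - y))) := by
  rw [intervalIntegral.integral_eq_sub_of_hasDerivAt (f := fun d => -Real.exp (-(lam * (d - y))))]
  · simp; ring
  · intro d _
    exact (exp_deriv lam y d).neg.congr_deriv (by simp)
  · exact (ww_cont lam y).intervalIntegrable _ _

lemma meas_DD (lam r : ℝ) : Measurable (fun q : ℝ × ℝ => DD lam r q.1 q.2) := by
  unfold DD
  have := (hh_cont r).measurable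
  refine Measurable.add (by fun_prop) (Measurable.ite ?_ measurable_const measurable_const)
  apply measurableSet_le <;> fun_prop

lemma int_DD_aux (lam r s y : ℝ) :
    IntervalIntegrable (fun d => ww lam y d * DD lam r s d) volume y 1 := by
  unfold DD
  simp_rw [mul_add (ww lam y _)]
  have h1 := ww_cont lam y
  have h2 := hh_cont r
  refine IntervalIntegrable.add (Continuous.intervalIntegrable (by fun_prop) _ _) ?_
  refine IntervalIntegrable.continuousOn_mul ?_ h1.continuousOn
  rw [intervalIntegrable_iff]
  refine Measure.integrableOn_of_bounded (M := 1) (by simp) ?_ ?_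
  · apply Measurable.aestronglyMeasurable
    refine Measurable.ite ?_ measurable_const measurable_const
    apply measurableSet_le <;> fun_prop
  · refine Filter.Eventually.of_forall (fun d => ?_)
    split_ifs <;> simp

lemma int_DD (lam r s y : ℝ) (hl : 0 < lam) (hr : 0 ≤ r) :
    ∫ d in y..1, ww lam y d * DD lam r s d
      = G1 lam r s y - Real.exp (-(lam * (1 - y))) * G1 lam r s 1 := by
  have h1 := cl_cont r
  have h2 := hh_cont r
  rw [integral_eq_of_hasDerivAt_off_countable
    (fun d => -(Real.exp (-(lam * (d - y))) * G1 lam r s d)) _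
    (s := {s - r / lam, s + r / lam}) (by simp) ?_ ?_ (int_DD_aux lam r s y)]
  · simp; ring
  · apply Continuous.continuousOn
    unfold G1
    fun_prop
  · rintro d ⟨-, hd⟩
    simp only [Set.mem_insert_iff, Set.mem_singleton_iff, not_or] at hd
    have k1 : lam * (s - d) ≠ r := by
      intro h; apply hd.1; rw [← h]; field_simp; ring
    have k2 : lam * (s - d) ≠ -r := by
      intro h; apply hd.2
      have : r = -(lam * (s - d)) := by linarith
      rw [this]; field_simp; ring
    have hlin : HasDerivAt (fun d => lam * (s - d)) (-lam) d := by
      simpa using ((hasDerivAt_id d).const_sub s).const_mul lam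
    have hc := (cl_deriv r _ hr k1 k2).comp d hlin
    have hH := (hh_deriv r _ hr k1 k2).comp d hlin
    have hL : HasDerivAt (fun d => r * (1 + lam * (2 - s - d))) (r * (-lam)) d := by
      have := ((((hasDerivAt_id d).const_sub (2 - s)).const_mul lam).const_add 1).const_mul r
      simpa using this
    have hG : HasDerivAt (fun d => G1 lam r s d) _ d := (hL.add hH).add hc
    refine (((exp_deriv lam y d).mul hG).neg).congr_deriv ?_
    unfold ww G1 DD
    ring

lemma int_DD' (lam r x y : ℝ) (hl : 0 < lam) (hr : 0 ≤ r) :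
    ∫ s in x..1, ww lam x s * DD lam r s y
      = G1 lam r y x - Real.exp (-(lam * (1 - x))) * G1 lam r y 1 := by
  rw [← int_DD lam r y x hl hr]
  congr 1
  funext s
  rw [DD_symm lam r s y hr]

lemma G1_cont (lam r y : ℝ) : Continuous (fun s => G1 lam r s y) := by
  have h1 := cl_cont r
  have h2 := hh_cont r
  unfold G1; fun_prop

lemma int_G1 (lam r x y : ℝ) (hl : 0 < lam) (hr : 0 ≤ r) :
    ∫ s in x..1, ww lam x s * G1 lam r s y
      = G2 lam r x y - Real.exp (-(lam * (1 - x))) * G2 lam r 1 y := by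
  have h1 := cl_cont r
  have h2 := hh_cont r
  have h3 := ww_cont lam x
  have h4 := G1_cont lam r y
  rw [integral_eq_of_hasDerivAt_off_countable
    (fun s => -(Real.exp (-(lam * (s - x))) * G2 lam r s y)) _
    (s := {y - r / lam, y + r / lam}) (by simp) ?_ ?_
    (Continuous.intervalIntegrable (by fun_prop) _ _)]
  · simp; ring
  · apply Continuous.continuousOn
    unfold G2
    fun_prop
  · rintro s ⟨-, hd⟩
    simp only [Set.mem_insert_iff, Set.mem_singleton_iff, not_or] at hd
    have k1 : lam * (s - y) ≠ r := by
      intro h; apply hd.2; rw [← h]; field_simp; ring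
    have k2 : lam * (s - y) ≠ -r := by
      intro h; apply hd.1
      have : r = -(lam * (s - y)) := by linarith
      rw [this]; field_simp; ring
    have hlin : HasDerivAt (fun s => lam * (s - y)) lam s := by
      simpa using ((hasDerivAt_id s).sub_const y).const_mul lam
    have hH := (hh_deriv r _ hr k1 k2).comp s hlin
    have hL : HasDerivAt (fun s => r * (lam * (2 - s - y))) (r * (-lam)) s := by
      have := (((((hasDerivAt_id s).const_sub 2).sub_const y).const_mul lam)).const_mul r
      simpa using this
    have hG : HasDerivAt (fun d => G2 lam r d y) _ s := hL.add hH
    refine (((exp_deriv lam x s).mul hG).neg).congr_deriv ?_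
    unfold ww G1 G2
    ring

lemma G2_bound (lam r y : ℝ) (hl : 0 < lam) (hr : 0 ≤ r) (hy : y ≤ 1) :
    |G2 lam r 1 y| ≤ 1 + r ^ 2 := by
  have hY : 0 ≤ lam * (1 - y) := mul_nonneg hl.le (by linarith)
  have : G2 lam r 1 y = r * (lam * (1 - y)) + hh r (lam * (1 - y)) := by unfold G2; ring_nf
  rw [this]
  generalize lam * (1 - y) = Y at hY
  unfold hh
  rcases le_total r Y with h | h
  · rw [cl_of_gt r Y hr h, abs_le]
    constructor <;> nlinarith
  · rw [cl_of_mid r Y (abs_le.2 ⟨by linarith, h⟩), abs_le]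
    constructor <;> nlinarith

lemma G1_bound (lam r y : ℝ) (hl : 0 < lam) (hr : 0 ≤ r) (hy : y ≤ 1) :
    |G1 lam r y 1| ≤ 1 + r ^ 2 + 2 * r := by
  have h1 := G2_bound lam r y hl hr hy
  rw [G2_symm lam r 1 y hr] at h1
  have h2 := cl_abs r (lam * (y - 1)) hr
  have : G1 lam r y 1 = G2 lam r y 1 + r + cl r (lam * (y - 1)) := by unfold G1 G2; ring
  rw [this]
  rw [abs_le] at *
  constructor <;> linarith [h1.1, h1.2, h2.1, h2.2]

lemma ww_nonneg (lam x t : ℝ) (hl : 0 ≤ lam) : 0 ≤ ww lam x t := by unfold ww; positivity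

lemma conv (lam x K : ℝ) (hl : 0 ≤ lam) (hx : x ≤ 1) (F : ℝ → ENNReal) (hF : Measurable F)
    (hK : ∀ t ∈ Set.Icc x 1, F t ≤ ENNReal.ofReal K) :
    (∫⁻ t in Set.Icc x 1, ENNReal.ofReal (ww lam x t) * F t).toReal
      = ∫ t in x..1, ww lam x t * (F t).toReal := by
  rw [intervalIntegral.integral_of_le hx, ← integral_Icc_eq_integral_Ioc]
  rw [← integral_toReal]
  · congr 1
    funext t
    rw [ENNReal.toReal_mul, ENNReal.toReal_ofReal (ww_nonneg lam x t hl)]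
  · exact (((measurable_ww lam x).ennreal_ofReal).mul hF).aemeasurable
  · filter_upwards [ae_restrict_mem measurableSet_Icc] with t ht
    exact ENNReal.mul_lt_top ENNReal.ofReal_lt_top ((hK t ht).trans_lt ENNReal.ofReal_lt_top)

lemma bnd_int (lam x K : ℝ) (hx : x ≤ 1) (f : ℝ → ℝ) (hf : Measurable f)
    (hK : ∀ t ∈ Set.Icc x 1, |f t| ≤ K) :
    IntervalIntegrable (fun t => ww lam x t * f t) volume x 1 := by
  refine IntervalIntegrable.continuousOn_mul ?_ (ww_cont lam x).continuousOn
  rw [intervalIntegrable_iff, Set.uIoc_of_le hx]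
  refine Measure.integrableOn_of_bounded (M := K) (by simp) hf.aestronglyMeasurable ?_
  filter_upwards [ae_restrict_mem measurableSet_Ioc] with t ht
  exact hK t ⟨ht.1.le, ht.2⟩

lemma bnd (lam x K : ℝ) (hl : 0 ≤ lam) (hx : x ≤ 1) (f : ℝ → ℝ)
    (hK : ∀ t ∈ Set.Icc x 1, |f t| ≤ K) :
    |∫ t in x..1, ww lam x t * f t| ≤ (1 - Real.exp (-(lam * (1 - x)))) * K := by
  rw [← int_ww, ← intervalIntegral.integral_mul_const]
  rw [← Real.norm_eq_abs]
  apply intervalIntegral.norm_integral_le_of_norm_le hx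
  · refine Filter.Eventually.of_forall (fun t ht => ?_)
    rw [norm_mul, Real.norm_of_nonneg (ww_nonneg lam x t hl)]
    exact mul_le_mul_of_nonneg_left (hK t ⟨ht.1.le, ht.2⟩) (ww_nonneg lam x t hl)
  · exact ((ww_cont lam x).mul continuous_const).intervalIntegrable _ _

/-- error function -/
def eE (lam r x y : ℝ) : ℝ := (1 + 2 * r) * (mE lam (r / lam) x y).toReal - DD lam r x y

lemma meas_eE (lam r : ℝ) : Measurable (fun q : ℝ × ℝ => eE lam r q.1 q.2) := by
  unfold eE
  exact ((measurable_mE lam (r / lam)).ennreal_toReal.const_mul _).sub (meas_DD lam r)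

lemma meas_sec_left {β : Type*} [MeasurableSpace β] (f : ℝ → ℝ → β)
    (hf : Measurable (fun q : ℝ × ℝ => f q.1 q.2)) (y : ℝ) : Measurable (fun s => f s y) :=
  hf.comp (measurable_id.prodMk measurable_const)
lemma meas_sec_right {β : Type*} [MeasurableSpace β] (f : ℝ → ℝ → β)
    (hf : Measurable (fun q : ℝ × ℝ => f q.1 q.2)) (x : ℝ) : Measurable (fun s => f x s) :=
  hf.comp (measurable_const.prodMk measurable_id)
lemma meas_mE_left (lam r y : ℝ) : Measurable (fun s => mE lam r s y) :=
  meas_sec_left (mE lam r) (measurable_mE lam r) y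
lemma meas_mE_right (lam r x : ℝ) : Measurable (fun s => mE lam r x s) :=
  meas_sec_right (mE lam r) (measurable_mE lam r) x

lemma exp_ge (lam x : ℝ) (hl : 0 < lam) (hx0 : 0 ≤ x) :
    Real.exp (-lam) ≤ Real.exp (-(lam * (1 - x))) := by
  apply Real.exp_le_exp.2; nlinarith

lemma exp_le (lam x : ℝ) (hl : 0 < lam) (hx : x ≤ 1) :
    Real.exp (-(lam * (1 - x))) ≤ 1 := by
  apply Real.exp_le_one_iff.2; nlinarith

def Bd (lam r C : ℝ) : Prop :=
  ∀ x ∈ Set.Icc (0:ℝ) 1, ∀ y ∈ Set.Icc (0:ℝ) 1, |eE lam r x y| ≤ C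

lemma near_iff (lam r x y : ℝ) (hl : 0 < lam) : |lam * (x - y)| ≤ r ↔ |x - y| ≤ r / lam := by
  rw [abs_mul, abs_of_pos hl, le_div_iff₀ hl, mul_comm]

lemma int_eE_right (lam r x y C : ℝ) (hl : 0 < lam) (hr : 0 ≤ r) (hx : x ∈ Set.Icc (0:ℝ) 1)
    (hy : y ∈ Set.Icc (0:ℝ) 1) (hC : Bd lam r C) :
    ∫ d in y..1, ww lam y d * eE lam r x d =
      (1 + 2 * r) * (∫⁻ d in Set.Icc y 1, ENNReal.ofReal (ww lam y d) * mE lam (r / lam) x d).toReal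
       - (G1 lam r x y - Real.exp (-(lam * (1 - y))) * G1 lam r x 1) := by
  have hm : ∀ t ∈ Set.Icc y 1, mE lam (r/lam) x t ≤ ENNReal.ofReal (Real.exp lam) :=
    fun t ht => mE_le lam _ x t hl.le hx.1 hx.2 ht.2
  rw [conv lam y _ hl.le hy.2 _ (meas_mE_right lam (r/lam) x) hm, ← int_DD lam r x y hl hr,
    ← intervalIntegral.integral_const_mul, ← intervalIntegral.integral_sub]
  · congr 1; funext d; unfold eE; ring
  · apply IntervalIntegrable.const_mul
    apply bnd_int lam y (Real.exp lam) hy.2 _ (meas_mE_right lam (r/lam) x).ennreal_toReal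
    intro t ht
    rw [abs_of_nonneg ENNReal.toReal_nonneg]
    exact ENNReal.toReal_le_of_le_ofReal (Real.exp_pos _).le (hm t ht)
  · exact int_DD_aux lam r x y

lemma int_eE_left (lam r x y C : ℝ) (hl : 0 < lam) (hr : 0 ≤ r) (hx : x ∈ Set.Icc (0:ℝ) 1)
    (hy : y ∈ Set.Icc (0:ℝ) 1) (hC : Bd lam r C) :
    ∫ s in x..1, ww lam x s * eE lam r s y =
      (1 + 2 * r) * (∫⁻ s in Set.Icc x 1, ENNReal.ofReal (ww lam x s) * mE lam (r / lam) s y).toReal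
       - (G1 lam r y x - Real.exp (-(lam * (1 - x))) * G1 lam r y 1) := by
  have hm : ∀ t ∈ Set.Icc x 1, mE lam (r/lam) t y ≤ ENNReal.ofReal (Real.exp lam) :=
    fun t ht => mE_le lam _ t y hl.le (hx.1.trans ht.1) ht.2 hy.2
  rw [conv lam x _ hl.le hx.2 _ (meas_mE_left lam (r/lam) y) hm, ← int_DD' lam r x y hl hr,
    ← intervalIntegral.integral_const_mul, ← intervalIntegral.integral_sub]
  · congr 1; funext d; unfold eE; ring
  · apply IntervalIntegrable.const_mul
    apply bnd_int lam x (Real.exp lam) hx.2 _ (meas_mE_left lam (r/lam) y).ennreal_toReal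
    intro t ht
    rw [abs_of_nonneg ENNReal.toReal_nonneg]
    exact ENNReal.toReal_le_of_le_ofReal (Real.exp_pos _).le (hm t ht)
  · have := int_DD_aux lam r y x
    refine this.congr (fun s _ => ?_)
    rw [DD_symm lam r s y hr]

lemma G1_far (lam r x y : ℝ) (hr : 0 ≤ r) (h : r < lam * (x - y)) : G1 lam r x y = DD lam r x y := by
  unfold G1 DD
  rw [if_neg (by rw [not_le]; exact h.trans_le (le_abs_self _)), cl_of_gt r _ hr h.le]; ring

lemma far_bound (r B β E q ei g e : ℝ) (hr : 0 ≤ r) (hB : 0 ≤ B) (hβ : β = 3 * (1 + r) ^ 2)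
    (hE : 1 - q ≤ E) (hE0 : 0 ≤ E) (hi : |ei| ≤ (1 - E) * (β + B)) (hg : |g| ≤ 1 + r ^ 2 + 2 * r)
    (he : e = ei - E * g) : |e| ≤ β + q * B := by
  have h1 : |E * g| ≤ E * β := by
    rw [abs_mul, abs_of_nonneg hE0]
    apply mul_le_mul_of_nonneg_left _ hE0
    nlinarith
  rw [he]
  calc |ei - E * g| ≤ |ei| + |E * g| := abs_sub _ _
    _ ≤ (1 - E) * (β + B) + E * β := by linarith
    _ ≤ _ := by nlinarith

lemma near_bound (r B β E F q ei g1 g2 g3 e : ℝ) (hr : 0 ≤ r) (hB : 0 ≤ B) (hβ : β = 3 * (1 + r) ^ 2)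
    (hE : 1 - q ≤ E) (hE0 : 0 ≤ E) (hE1 : E ≤ 1) (hF0 : 0 ≤ F) (hF1 : F ≤ 1)
    (hi : |ei| ≤ (1 - E) * ((1 - F) * (β + B)))
    (hg1 : |g1| ≤ 1 + r ^ 2) (hg2 : |g2| ≤ 1 + r ^ 2) (hg3 : |g3| ≤ 1 + r ^ 2)
    (he : e = ei - E * g1 - F * g2 + E * F * g3) : |e| ≤ β + q * B := by
  have hEF : 0 ≤ E * F := mul_nonneg hE0 hF0
  have k1 : |E * g1| ≤ E * (1 + r^2) := by
    rw [abs_mul, abs_of_nonneg hE0]; exact mul_le_mul_of_nonneg_left hg1 hE0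
  have k2 : |F * g2| ≤ F * (1 + r^2) := by
    rw [abs_mul, abs_of_nonneg hF0]; exact mul_le_mul_of_nonneg_left hg2 hF0
  have k3 : |E * F * g3| ≤ E * F * (1 + r^2) := by
    rw [abs_mul, abs_of_nonneg hEF]; exact mul_le_mul_of_nonneg_left hg3 hEF
  have hb : 3 * (1 + r^2) ≤ β := by nlinarith
  have h0 : 0 ≤ E + F - E * F := by nlinarith
  have h3 : (E + F + E * F) * (1 + r^2) ≤ (E + F - E * F) * β := by
    calc _ ≤ (3 * (E + F - E * F)) * (1 + r^2) := by
          apply mul_le_mul_of_nonneg_right _ (by positivity)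
          nlinarith
      _ = (E + F - E * F) * (3 * (1 + r^2)) := by ring
      _ ≤ _ := mul_le_mul_of_nonneg_left hb h0
  have h4 : (1 - E) * (1 - F) * B ≤ q * B := by
    apply mul_le_mul_of_nonneg_right _ hB
    nlinarith
  have h5 : |e| ≤ |ei| + |E * g1| + |F * g2| + |E * F * g3| := by
    rw [he]
    have := abs_add_le (ei - E * g1 - F * g2) (E * F * g3)
    have := abs_sub (ei - E * g1) (F * g2)
    have := abs_sub ei (E * g1)
    linarith
  nlinarith

lemma contract (lam r B : ℝ) (hl : 0 < lam) (hr : 0 ≤ r) (hB : 0 ≤ B)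
    (h : Bd lam r (3 * (1 + r) ^ 2 + B)) :
    Bd lam r (3 * (1 + r) ^ 2 + (1 - Real.exp (-lam)) * B) := by
  intro x hx y hy
  have hρ : 0 ≤ r / lam := by positivity
  have hDle := near_iff lam r x y hl
  have hX := exp_ge lam x hl hx.1
  have hY := exp_ge lam y hl hy.1
  have hX1 := exp_le lam x hl hx.2
  have hY1 := exp_le lam y hl hy.2
  have b1 : ∀ s ∈ Set.Icc (0:ℝ) 1, |∫ d in y..1, ww lam y d * eE lam r s d| ≤
      (1 - Real.exp (-(lam * (1 - y)))) * (3 * (1 + r) ^ 2 + B) := fun s hs =>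
    bnd lam y _ hl.le hy.2 _ (fun d hd => h s hs d ⟨hy.1.trans hd.1, hd.2⟩)
  by_cases hc : |x - y| ≤ r / lam
  · have v := fun s (hs : s ∈ Set.Icc x 1) =>
      int_eE_right lam r s y _ hl hr ⟨hx.1.trans hs.1, hs.2⟩ hy h
    let U : ℝ → ENNReal := fun s =>
      ∫⁻ d in Set.Icc y 1, ENNReal.ofReal (ww lam y d) * mE lam (r / lam) s d
    have hU : Measurable U := by
      have : Measurable (fun q : ℝ × ℝ => ENNReal.ofReal (ww lam y q.2) * mE lam (r / lam) q.1 q.2) :=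
        ((measurable_ww lam y).comp measurable_snd).ennreal_ofReal.mul (measurable_mE lam (r/lam))
      exact Measurable.lintegral_prod_right this
    have hUle : ∀ s ∈ Set.Icc x 1, U s ≤ ENNReal.ofReal (lam * Real.exp lam) := by
      intro s hs
      calc U s ≤ ∫⁻ d in Set.Icc y 1, ENNReal.ofReal (lam * Real.exp lam) := by
            apply setLIntegral_mono' measurableSet_Icc
            intro d hd
            rw [ENNReal.ofReal_mul hl.le]
            apply mul_le_mul' _ (mE_le lam _ s d hl.le (hx.1.trans hs.1) hs.2 hd.2)
            apply ENNReal.ofReal_le_ofReal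
            unfold ww
            have : Real.exp (-(lam * (d - y))) ≤ 1 := by
              apply Real.exp_le_one_iff.2; nlinarith [hd.1]
            nlinarith
        _ ≤ _ := by
            rw [setLIntegral_const, Real.volume_Icc]
            calc _ ≤ ENNReal.ofReal (lam * Real.exp lam) * 1 := by
                  gcongr
                  rw [← ENNReal.ofReal_one]
                  exact ENNReal.ofReal_le_ofReal (by linarith [hy.1])
              _ = _ := mul_one _
    have hA := congrArg ENNReal.toReal (AE_eq lam (r/lam) x y hl.le)
    rw [conv lam x _ hl.le hx.2 U hU hUle] at hA
    have hAt : AE lam (r/lam) x y ≠ ⊤ := by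
      have h1 := mE_le lam (r/lam) x y hl.le hx.1 hx.2 hy.2
      rw [mE_near lam _ x y hl.le hx.2 hy.2 hc] at h1
      intro h2
      rw [h2] at h1
      simp at h1
    have hm : (mE lam (r/lam) x y).toReal = 1 + (AE lam (r/lam) x y).toReal := by
      rw [mE_near lam _ x y hl.le hx.2 hy.2 hc, ENNReal.toReal_add (by simp) hAt]; simp
    have c1 := G1_cont lam r y
    have c2 := G1_cont lam r 1
    have c3 := ww_cont lam x
    have i1 : IntervalIntegrable (fun s => ww lam x s * (U s).toReal) volume x 1 := by
      apply bnd_int lam x (lam * Real.exp lam) hx.2 _ hU.ennreal_toReal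
      intro s hs
      rw [abs_of_nonneg ENNReal.toReal_nonneg]
      exact ENNReal.toReal_le_of_le_ofReal (by positivity) (hUle s hs)
    have key : ∫ s in x..1, ww lam x s * (∫ d in y..1, ww lam y d * eE lam r s d)
        = (1 + 2 * r) * (AE lam (r/lam) x y).toReal
          - ((G2 lam r x y - Real.exp (-(lam * (1 - x))) * G2 lam r 1 y)
           - Real.exp (-(lam * (1 - y))) * (G2 lam r x 1 - Real.exp (-(lam * (1 - x))) * G2 lam r 1 1)) := by
      rw [← int_G1 lam r x y hl hr, ← int_G1 lam r x 1 hl hr, hA,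
        ← intervalIntegral.integral_const_mul, ← intervalIntegral.integral_const_mul,
        ← intervalIntegral.integral_sub, ← intervalIntegral.integral_sub]
      · apply intervalIntegral.integral_congr
        intro s hs
        rw [Set.uIcc_of_le hx.2] at hs
        simp only
        rw [v s hs]
        ring
      · exact i1.const_mul _
      · exact Continuous.intervalIntegrable (by fun_prop) _ _
      · exact Continuous.intervalIntegrable (by fun_prop) _ _
      · exact Continuous.intervalIntegrable (by fun_prop) _ _
    have b2 := bnd lam x _ hl.le hx.2 (fun s => ∫ d in y..1, ww lam y d * eE lam r s d)
      (fun s hs => b1 s ⟨hx.1.trans hs.1, hs.2⟩)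
    have g2 := G2_bound lam r x hl hr hx.2
    rw [G2_symm lam r 1 x hr] at g2
    refine near_bound r B _ _ _ (1 - Real.exp (-lam)) _ (G2 lam r 1 y) (G2 lam r x 1) (G2 lam r 1 1) _
      hr hB rfl (by linarith) (Real.exp_pos _).le hX1 (Real.exp_pos _).le hY1 b2
      (G2_bound lam r y hl hr hy.2) g2 (G2_bound lam r 1 hl hr le_rfl) ?_
    rw [key, eE, hm]
    have : DD lam r x y = 1 + 2 * r + G2 lam r x y := by
      unfold DD G2; rw [if_pos (hDle.2 hc)]; ring
    rw [this]; ring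
  · have hc' : ¬ |lam * (x - y)| ≤ r := fun h => hc (hDle.1 h)
    rw [not_le, lt_abs] at hc'
    rcases hc' with h1 | h1
    · have h2 : y < x - r / lam := by
        have : r / lam < x - y := by rw [div_lt_iff₀ hl]; linarith
        linarith
      have k := int_eE_right lam r x y _ hl hr hx hy h
      rw [← mE_right lam (r/lam) x y hl.le hρ h2] at k
      refine far_bound r B _ _ _ _ (G1 lam r x 1) _ hr hB rfl (by linarith) (Real.exp_pos _).le
        (b1 x hx) (G1_bound lam r x hl hr hx.2) ?_
      rw [k, eE, G1_far lam r x y hr h1]; ring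
    · have h1' : r < lam * (y - x) := by linarith
      have h2 : x < y - r / lam := by
        have : r / lam < y - x := by rw [div_lt_iff₀ hl]; linarith
        linarith
      have k := int_eE_left lam r x y _ hl hr hx hy h
      rw [← mE_left lam (r/lam) x y hl.le hρ h2] at k
      have b2 := bnd lam x _ hl.le hx.2 (fun s => eE lam r s y)
        (fun s hs => h s ⟨hx.1.trans hs.1, hs.2⟩ y hy)
      refine far_bound r B _ _ _ _ (G1 lam r y 1) _ hr hB rfl (by linarith) (Real.exp_pos _).le
        b2 (G1_bound lam r y hl hr hy.2) ?_
      rw [k, eE, G1_far lam r y x hr h1', DD_symm lam r x y hr]; ring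

lemma Bd_init (lam r : ℝ) (hl : 0 < lam) (hr : 0 ≤ r) :
    ∃ B, 0 ≤ B ∧ Bd lam r (3 * (1 + r) ^ 2 + B) := by
  have hc := hh_cont r
  obtain ⟨C, hC⟩ := (isCompact_Icc (a := -lam) (b := lam)).exists_bound_of_continuousOn hc.continuousOn
  have hC0 : 0 ≤ C := (norm_nonneg _).trans (hC 0 ⟨by linarith, hl.le⟩)
  refine ⟨(1 + 2 * r) * Real.exp lam + (r * (2 + 2 * lam) + C + 1), by positivity, ?_⟩
  intro x hx y hy
  have h1 : (mE lam (r/lam) x y).toReal ≤ Real.exp lam :=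
    ENNReal.toReal_le_of_le_ofReal (Real.exp_pos _).le (mE_le lam _ x y hl.le hx.1 hx.2 hy.2)
  have h2 : |(1 + 2 * r) * (mE lam (r/lam) x y).toReal| ≤ (1 + 2 * r) * Real.exp lam := by
    rw [abs_of_nonneg (by positivity)]
    gcongr
  have h3 : |DD lam r x y| ≤ r * (2 + 2 * lam) + C + 1 := by
    unfold DD
    have a1 : |r * (2 + lam * (2 - x - y))| ≤ r * (2 + 2 * lam) := by
      rw [abs_of_nonneg]
      · apply mul_le_mul_of_nonneg_left _ hr
        nlinarith [hx.1, hy.1]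
      · have : 0 ≤ lam * (2 - x - y) := mul_nonneg hl.le (by linarith [hx.2, hy.2])
        positivity
    have a2 : |hh r (lam * (x - y))| ≤ C := by
      apply hC
      constructor <;> nlinarith [hx.1, hy.1, hx.2, hy.2]
    have a3 : |(if |lam * (x - y)| ≤ r then (1:ℝ) else 0)| ≤ 1 := by split_ifs <;> simp
    have := abs_add_le (r * (2 + lam * (2 - x - y)) + hh r (lam * (x - y))) (if |lam * (x - y)| ≤ r then (1:ℝ) else 0)
    have := abs_add_le (r * (2 + lam * (2 - x - y))) (hh r (lam * (x - y)))
    linarith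
  have := abs_sub ((1 + 2 * r) * (mE lam (r/lam) x y).toReal) (DD lam r x y)
  unfold eE
  have : 0 ≤ 3 * (1 + r)^2 := by positivity
  linarith

lemma Bd_final (lam r : ℝ) (hl : 0 < lam) (hr : 0 ≤ r) : Bd lam r (3 * (1 + r) ^ 2) := by
  obtain ⟨B, hB, h0⟩ := Bd_init lam r hl hr
  have hq0 : 0 ≤ 1 - Real.exp (-lam) := by
    have := Real.exp_le_one_iff.2 (show -lam ≤ 0 by linarith); linarith
  have hq1 : 1 - Real.exp (-lam) < 1 := by linarith [Real.exp_pos (-lam)]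
  have hk : ∀ k : ℕ, Bd lam r (3 * (1 + r) ^ 2 + (1 - Real.exp (-lam)) ^ k * B) := by
    intro k
    induction k with
    | zero => simpa using h0
    | succ k ih =>
      have := contract lam r _ hl hr (by positivity) ih
      rwa [← mul_assoc, ← pow_succ'] at this
  intro x hx y hy
  have ht : Filter.Tendsto (fun k : ℕ => 3 * (1 + r) ^ 2 + (1 - Real.exp (-lam)) ^ k * B) Filter.atTop
      (nhds (3 * (1 + r)^2 + 0 * B)) :=
    ((tendsto_pow_atTop_nhds_zero_of_lt_one hq0 hq1).mul_const B).const_add _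
  rw [zero_mul, add_zero] at ht
  exact ge_of_tendsto' ht (fun k => hk k x hx y hy)

lemma AE_ne_top (lam r : ℝ) (hl : 0 < lam) (hr : 0 ≤ r) : AE lam (r / lam) 0 0 ≠ ⊤ := by
  have h1 := mE_le lam (r/lam) 0 0 hl.le le_rfl zero_le_one zero_le_one
  rw [mE_near lam _ 0 0 hl.le zero_le_one zero_le_one (by simp; positivity)] at h1
  intro h2
  rw [h2] at h1
  simp at h1

lemma AE_bound (lam r : ℝ) (hl : 0 < lam) (hr : 0 ≤ r) :
    |(1 + 2 * r) * (AE lam (r / lam) 0 0).toReal - 2 * r * lam| ≤ 3 * (1 + r) ^ 2 + 1 := by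
  have h := Bd_final lam r hl hr 0 (by simp) 0 (by simp)
  have hm : (mE lam (r/lam) 0 0).toReal = 1 + (AE lam (r/lam) 0 0).toReal := by
    rw [mE_near lam _ 0 0 hl.le zero_le_one zero_le_one (by simp; positivity),
      ENNReal.toReal_add (by simp) (AE_ne_top lam r hl hr)]; simp
  have hD : DD lam r 0 0 = 2 * r + 2 * r * lam := by
    unfold DD hh
    rw [if_pos (by simpa using hr), cl_of_mid r _ (by simpa using hr)]
    ring
  rw [eE, hm, hD, abs_le] at h
  rw [abs_le]
  constructor <;> linarith [h.1, h.2]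

instance unifI_prob : IsProbabilityMeasure unifI := by
  constructor
  simp [unifI]

/-- product uniform measure -/
def UI (a : ℕ) : Measure (Fin a → ℝ) := Measure.pi fun _ => unifI

instance UI_prob (a : ℕ) : IsProbabilityMeasure (UI a) := by unfold UI; infer_instance

lemma UI_box (a : ℕ) : (volume : Measure (Fin a → ℝ)).restrict (box a 0) = UI a := by
  unfold UI unifI box
  rw [volume_pi, Measure.restrict_pi_pi]

lemma UI_succ (a : ℕ) (G : (Fin (a+1) → ℝ) → ENNReal) (hG : Measurable G) :
    ∫⁻ z, G z ∂(UI (a+1)) = ∫⁻ t, ∫⁻ z, G (Fin.cons t z) ∂(UI a) ∂unifI := by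
  have hmp := (measurePreserving_piFinSuccAbove (fun _ : Fin (a+1) => unifI) 0).symm
  unfold UI
  rw [← hmp.lintegral_comp hG, lintegral_prod _ (by
      apply Measurable.aemeasurable
      exact hG.comp (MeasurableEquiv.measurable _))]
  congr 1
  funext t
  congr 1
  funext z
  have : (MeasurableEquiv.piFinSuccAbove (fun _ : Fin (a + 1) => ℝ) 0).symm (t, z)
        = Fin.insertNth (α := fun _ => ℝ) 0 t z := rfl
  rw [this, Fin.insertNth_zero']

/-- fixed-size expected matching number -/
def nv (ρ : ℝ) (a b : ℕ) : ENNReal :=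
  ∫⁻ S, ∫⁻ D, ((MM ρ S D : ℕ) : ENNReal) ∂(UI b) ∂(UI a)

lemma meas_MMU (ρ : ℝ) (a b : ℕ) :
    Measurable (fun S : Fin a → ℝ => ∫⁻ D, ((MM ρ S D : ℕ) : ENNReal) ∂(UI b)) :=
  Measurable.lintegral_prod_right (f := fun (S : Fin a → ℝ) (D : Fin b → ℝ) => ((MM ρ S D : ℕ) : ENNReal))
    (meas_MM ρ measurable_fst measurable_snd)

lemma nv_swap (ρ : ℝ) (a b : ℕ) : nv ρ a b = nv ρ b a := by
  unfold nv
  rw [lintegral_lintegral_swap]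
  · simp_rw [fun (S : Fin a → ℝ) (D : Fin b → ℝ) => MM_swap ρ S D]
  · exact (meas_MM ρ measurable_fst measurable_snd).aemeasurable

lemma nv_succ (ρ : ℝ) (a b : ℕ) : nv ρ (a+1) b =
    ∫⁻ t, ∫⁻ S, ∫⁻ D, ((MM ρ (Fin.cons t S : Fin (a+1) → ℝ) D : ℕ) : ENNReal) ∂(UI b) ∂(UI a) ∂unifI := by
  unfold nv
  rw [UI_succ a _ (meas_MMU ρ (a+1) b)]

lemma nv_le_succ (ρ : ℝ) (a b : ℕ) : nv ρ a b ≤ nv ρ (a+1) b := by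
  rw [nv_succ]
  calc nv ρ a b = ∫⁻ _, nv ρ a b ∂unifI := by simp
    _ ≤ _ := by
      apply lintegral_mono; intro t
      apply lintegral_mono; intro S
      apply lintegral_mono; intro D
      exact Nat.cast_le.2 (MM_le_cons ρ t S D)

lemma nv_succ_le (ρ : ℝ) (a b : ℕ) : nv ρ (a+1) b ≤ nv ρ a b + 1 := by
  rw [nv_succ]
  calc _ ≤ ∫⁻ _ : ℝ, (∫⁻ S, ∫⁻ D, ((MM ρ S D : ℕ) : ENNReal) + 1 ∂(UI b) ∂(UI a)) ∂unifI := by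
        apply lintegral_mono; intro t
        apply lintegral_mono; intro S
        apply lintegral_mono; intro D
        have h : ((MM ρ (Fin.cons t S : Fin (a+1) → ℝ) D : ℕ) : ENNReal) ≤ ((MM ρ S D + 1 : ℕ) : ENNReal) :=
          Nat.cast_le.2 (MM_cons_le ρ t S D)
        simpa using h
    _ = nv ρ a b + 1 := by
        have : ∀ S : Fin a → ℝ, ∫⁻ D, ((MM ρ S D : ℕ) : ENNReal) + 1 ∂(UI b)
            = ∫⁻ D, ((MM ρ S D : ℕ) : ENNReal) ∂(UI b) + 1 := by
          intro S
          rw [lintegral_add_right _ measurable_const]; simp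
        simp_rw [this]
        rw [lintegral_add_right _ measurable_const]
        simp [nv]

lemma nv_add (ρ : ℝ) (a b k : ℕ) : nv ρ a b ≤ nv ρ (a+k) b ∧ nv ρ (a+k) b ≤ nv ρ a b + k := by
  induction k with
  | zero => simp
  | succ k ih =>
    refine ⟨ih.1.trans (nv_le_succ ρ (a+k) b), (nv_succ_le ρ (a+k) b).trans ?_⟩
    push_cast
    rw [← add_assoc]
    gcongr
    exact ih.2

def dd (n a : ℕ) : ENNReal := ENNReal.ofReal |(a:ℝ) - n|

lemma dd_add (a k : ℕ) : dd a (a+k) = k := by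
  simp [dd]
lemma dd_symm (a k : ℕ) : dd a k = dd k a := by
  unfold dd; rw [abs_sub_comm]

lemma nv_lip (ρ : ℝ) (a n b : ℕ) : nv ρ a b ≤ nv ρ n b + dd n a := by
  rcases le_total a n with h | h
  · obtain ⟨k, rfl⟩ := Nat.exists_eq_add_of_le h
    exact (nv_add ρ a b k).1.trans le_self_add
  · obtain ⟨k, rfl⟩ := Nat.exists_eq_add_of_le h
    rw [dd_add]
    exact (nv_add ρ n b k).2

lemma nv_lip2 (ρ : ℝ) (a b n m : ℕ) : nv ρ a b ≤ nv ρ n m + (dd n a + dd m b) := by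
  calc nv ρ a b ≤ nv ρ n b + dd n a := nv_lip ρ a n b
    _ ≤ (nv ρ n m + dd m b) + dd n a := by
        gcongr
        rw [nv_swap ρ n b, nv_swap ρ n m]
        exact nv_lip ρ b m n
    _ = _ := by ring

lemma AE_nv (lam ρ : ℝ) : AE lam ρ 0 0 = ∑' a, cc lam 0 a * ∑' b, cc lam 0 b * nv ρ a b := by
  unfold AE PP
  simp_rw [UI_box]
  congr 1; funext a; congr 1
  rw [lintegral_tsum (fun b => ((meas_MMU ρ a b).const_mul _).aemeasurable)]
  congr 1; funext b
  rw [lintegral_const_mul _ (meas_MMU ρ a b)]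
  rfl

lemma cc_sum (lam : ℝ) (hl : 0 ≤ lam) : ∑' a, cc lam 0 a = 1 := by
  have := PP_one lam 0 hl zero_le_one
  unfold PP at this
  simp_rw [UI_box] at this
  simpa using this

def del (n : ℕ) : ENNReal := ∑' a, cc n 0 a * dd n a

lemma sum_const (n : ℕ) (C : ENNReal) :
    ∑' a, cc n 0 a * ∑' b, cc n 0 b * (C + (dd n a + dd n b)) = C + (del n + del n) := by
  have h1 := cc_sum n (Nat.cast_nonneg n)
  simp_rw [mul_add, ENNReal.tsum_add, ENNReal.tsum_mul_right, h1]
  simp_rw [one_mul, mul_add, ENNReal.tsum_add, ENNReal.tsum_mul_right, h1, one_mul]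
  rfl

lemma AE_le (n : ℕ) (ρ : ℝ) : AE n ρ 0 0 ≤ nv ρ n n + (del n + del n) := by
  rw [AE_nv, ← sum_const]
  gcongr with a b
  exact nv_lip2 ρ a b n n

lemma le_AE (n : ℕ) (ρ : ℝ) : nv ρ n n ≤ AE n ρ 0 0 + (del n + del n) := by
  have h1 := cc_sum n (Nat.cast_nonneg n)
  have h0 := sum_const n 0
  simp only [zero_add] at h0
  rw [AE_nv, ← h0, ← ENNReal.tsum_add]
  simp_rw [← mul_add, ← ENNReal.tsum_add, ← mul_add]
  calc nv ρ n n = ∑' a, cc n 0 a * ∑' b, cc n 0 b * nv ρ n n := by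
        simp_rw [ENNReal.tsum_mul_right, h1, one_mul]
    _ ≤ _ := by
        gcongr with a b
        have := nv_lip2 ρ n n a b
        rwa [dd_symm a n, dd_symm b n] at this

def pw (lam : ℝ) (a : ℕ) : ℝ := Real.exp (-(lam * (1 - 0))) * lam ^ a / a.factorial

lemma hs_congr {f g : ℕ → ℝ} {c d : ℝ} (h : HasSum f c) (hf : ∀ a, g a = f a) (hc : d = c) :
    HasSum g d := by
  have : g = f := funext hf
  rw [this, hc]; exact h

lemma pw_sum (lam : ℝ) : HasSum (pw lam) 1 := by
  have := (NormedSpace.expSeries_div_hasSum_exp lam).mul_left (Real.exp (-lam))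
  rw [← Real.exp_eq_exp_ℝ, ← Real.exp_add] at this
  simp only [neg_add_cancel, Real.exp_zero] at this
  refine hs_congr this (fun a => ?_) rfl
  unfold pw; rw [sub_zero, mul_one, mul_div_assoc]

lemma pw_shift (lam c : ℝ) (g f : ℕ → ℝ) (h : HasSum (fun a => pw lam a * g a) c) (h0 : f 0 = 0)
    (hf : ∀ a, f (a+1) = (a + 1) * g a) : HasSum (fun a => pw lam a * f a) (lam * c) := by
  have := (hasSum_nat_add_iff (f := fun a => pw lam a * f a) (g := lam * c) 1).1 (by
    refine hs_congr (h.mul_left lam) (fun a => ?_) rfl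
    simp only [hf, pw, pow_succ, Nat.factorial_succ]
    push_cast
    have : ((a:ℝ) + 1) ≠ 0 := by positivity
    have : (a.factorial : ℝ) ≠ 0 := by positivity
    field_simp)
  simpa [h0] using this

lemma pw_var (lam : ℝ) : HasSum (fun a => pw lam a * ((a:ℝ) - lam) ^ 2) lam := by
  have h0 : HasSum (fun a => pw lam a * 1) 1 := by simpa using pw_sum lam
  have h1 := pw_shift lam 1 _ (fun a => (a:ℝ)) h0 (by simp) (by intro a; push_cast; ring)
  have h2 := pw_shift lam _ _ (fun a => (a:ℝ) * (a - 1)) h1 (by simp) (by intro a; push_cast; ring)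
  have := (h2.add (h1.mul_left (1 - 2 * lam))).add (h0.mul_left (lam ^ 2))
  refine hs_congr this (fun a => ?_) ?_
  · ring
  · ring

lemma del_le (n : ℕ) (hn : 1 ≤ n) : del n ≤ ENNReal.ofReal (Real.sqrt n) := by
  have hn' : (0:ℝ) < n := by exact_mod_cast hn
  have hs : 0 < Real.sqrt n := Real.sqrt_pos.2 hn'
  have hS : HasSum (fun a : ℕ => pw n a * ((Real.sqrt n + ((a:ℝ) - n) ^ 2 / Real.sqrt n) / 2)) (Real.sqrt n) := by
    have := ((pw_sum n).mul_left (Real.sqrt n / 2)).add ((pw_var n).mul_left (1 / (2 * Real.sqrt n)))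
    refine hs_congr this (fun a => ?_) ?_
    · field_simp
    · have h := Real.mul_self_sqrt hn'.le
      field_simp
      nlinarith
  have hpw : ∀ a, 0 ≤ pw n a := fun a => by unfold pw; positivity
  rw [← hS.tsum_eq, ENNReal.ofReal_tsum_of_nonneg _ hS.summable]
  · unfold del
    gcongr with a
    rw [ENNReal.ofReal_mul (hpw a)]
    refine mul_le_mul' le_rfl (ENNReal.ofReal_le_ofReal ?_)
    rw [le_div_iff₀ two_pos, ← sub_nonneg]
    have : Real.sqrt n + ((a:ℝ) - n)^2 / Real.sqrt n - |(a:ℝ) - n| * 2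
        = (Real.sqrt n - |(a:ℝ) - n|)^2 / Real.sqrt n := by
      rw [← sq_abs ((a:ℝ) - n)]
      field_simp; ring
    rw [this]; positivity
  · intro a
    have := hpw a
    positivity

lemma nv_le (ρ : ℝ) (a b : ℕ) : nv ρ a b ≤ a := by
  unfold nv
  calc _ ≤ ∫⁻ _ : Fin a → ℝ, ∫⁻ _ : Fin b → ℝ, (a : ENNReal) ∂(UI b) ∂(UI a) := by
        apply lintegral_mono; intro S
        apply lintegral_mono; intro D
        exact Nat.cast_le.2 (MM_le_left ρ S D)
    _ = a := by simp

lemma nv_real (n : ℕ) (ρ : ℝ) :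
    ∫ S, ∫ D, (MM ρ S D : ℝ) ∂(UI n) ∂(UI n) = (nv ρ n n).toReal := by
  unfold nv
  have hin : ∀ S : Fin n → ℝ, ∫⁻ D, ((MM ρ S D : ℕ) : ENNReal) ∂(UI n) < ⊤ := by
    intro S
    calc _ ≤ ∫⁻ _ : Fin n → ℝ, (n : ENNReal) ∂(UI n) :=
          lintegral_mono (fun D => Nat.cast_le.2 (MM_le_left ρ S D))
      _ < ⊤ := by simp
  rw [← integral_toReal (meas_MMU ρ n n).aemeasurable (Filter.Eventually.of_forall hin)]
  congr 1; funext S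
  rw [← integral_toReal (meas_MM ρ (S := fun _ : Fin n → ℝ => S) (D := fun D => D) measurable_const measurable_id).aemeasurable
    (Filter.Eventually.of_forall (fun D => ENNReal.natCast_lt_top _))]
  simp

lemma nu_bound (n : ℕ) (hn : 1 ≤ n) (r : ℝ) (hr : 0 ≤ r) :
    |(nv (r / n) n n).toReal / n - r / (r + 1 / 2)| ≤
      (3 * (1 + r) ^ 2 + 1) / n + 2 * (Real.sqrt n / n) := by
  have hn' : (0:ℝ) < n := by exact_mod_cast hn
  have hA := AE_bound n r hn' hr
  have hAt := AE_ne_top n r hn' hr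
  have hd : del n ≠ ⊤ := ((del_le n hn).trans_lt ENNReal.ofReal_lt_top).ne
  have hd' : (del n).toReal ≤ Real.sqrt n :=
    ENNReal.toReal_le_of_le_ofReal (Real.sqrt_nonneg _) (del_le n hn)
  have hnt : nv (r/n) n n ≠ ⊤ := ((nv_le (r/n) n n).trans_lt (ENNReal.natCast_lt_top _)).ne
  have h1 := ENNReal.toReal_mono (by finiteness) (AE_le n (r/n))
  have h2 := ENNReal.toReal_mono (by finiteness) (le_AE n (r/n))
  rw [ENNReal.toReal_add (by assumption) (by finiteness), ENNReal.toReal_add hd hd] at h1 h2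
  generalize (AE n (r/n) 0 0).toReal = A at *
  generalize (nv (r/n) n n).toReal = N at *
  have h3 : |A - 2 * r * n / (1 + 2 * r)| ≤ 3 * (1 + r)^2 + 1 := by
    have : A - 2 * r * n / (1 + 2 * r) = ((1 + 2 * r) * A - 2 * r * n) / (1 + 2 * r) := by
      field_simp
    rw [this, abs_div, abs_of_pos (by positivity : 0 < 1 + 2 * r)]
    exact (div_le_self (abs_nonneg _) (by linarith)).trans hA
  have h4 : N / n - r / (r + 1/2) = (N - 2 * r * n / (1 + 2 * r)) / n := by
    have : r + 1/2 ≠ 0 := by positivity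
    field_simp
    ring
  rw [h4, abs_div, abs_of_pos hn', mul_div_assoc', ← add_div]
  apply div_le_div_of_nonneg_right _ hn'.le
  rw [abs_le] at *
  constructor <;> linarith [h3.1, h3.2]

lemma nv_tendsto (r : ℝ) (hr : 0 ≤ r) :
    Filter.Tendsto (fun n : ℕ => (nv (r / n) n n).toReal / n) Filter.atTop
        (nhds (r / (r + 1 / 2))) := by
  rw [tendsto_iff_dist_tendsto_zero]
  have hs : Filter.Tendsto (fun n : ℕ => Real.sqrt n / n) Filter.atTop (nhds 0) := by
    simp_rw [Real.sqrt_div_self']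
    simp only [one_div]
    exact (Real.tendsto_sqrt_atTop.comp tendsto_natCast_atTop_atTop).inv_tendsto_atTop
  have hb : Filter.Tendsto (fun n : ℕ => (3 * (1 + r) ^ 2 + 1) / (n:ℝ) + 2 * (Real.sqrt n / n))
      Filter.atTop (nhds (0 + 2 * 0)) :=
    (tendsto_const_div_atTop_nhds_zero_nat _).add (hs.const_mul 2)
  rw [mul_zero, add_zero] at hb
  refine squeeze_zero' (Filter.Eventually.of_forall (fun n => dist_nonneg)) ?_ hb
  filter_upwards [Filter.eventually_ge_atTop 1] with n hn
  rw [Real.dist_eq]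
  exact nu_bound n hn r hr

lemma nuDual_zero_b (n : ℕ) (r p : ℝ) : nuDual n r 0 p = (nv (r / n) n n).toReal := by
  rw [← nv_real]
  unfold nuDual UI MM
  simp

lemma nuDual_zero_p (n : ℕ) (r b : ℝ) : nuDual n r b 0 = (nv (r / n) n n).toReal := by
  rw [← nv_real]
  unfold nuDual UI MM
  simp

/-- **Exact matching rate in the dual service-range model with no flexibility.**
(a) For any base range `r ≥ 0` and any `p ∈ [0,1]`, if the extra range is `b = 0` then
`lim_{n→∞} ν_n(r, 0, p)/n = r/(r + 1/2)`; and (b) for any `r ≥ 0` and any `b ≥ 0`, if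
the flexible fraction is `p = 0` then `lim_{n→∞} ν_n(r, b, 0)/n = r/(r + 1/2)`. -/
theorem dual_service_range_no_flexibility (r b p : ℝ)
    (hr : 0 ≤ r) (hb : 0 ≤ b) (hp : p ∈ Set.Icc (0 : ℝ) 1) :
    Filter.Tendsto (fun n : ℕ => nuDual n r 0 p / n) Filter.atTop
        (nhds (r / (r + 1 / 2))) ∧
      Filter.Tendsto (fun n : ℕ => nuDual n r b 0 / n) Filter.atTop
        (nhds (r / (r + 1 / 2))) := by
  simp_rw [nuDual_zero_b, nuDual_zero_p]
  exact ⟨nv_tendsto r hr, nv_tendsto r hr⟩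

end
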